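/- arXiv:2101.02193 — 2 statements merged into one kernel-verified Lean document; each statement's English description precedes it below -/
import Mathlib

section
/- Let R be a nontrivial cyclically reduced element of the commutator subgroup F(a,b)' of F(a,b). Then the following are equivalent: (i) there exists a compact convex subset K of ℝ² contained in an affine line (i.e., K is a single point or a line segment) such that the convex hull of the trace of R equals the Minkowski sum K + [0,1]×[0,1]; (ii) there exists T in the Aut(F(a,b))-orbit of R which has shortest length in that orbit and lies in ⟨a, b⁻¹ab⟩. (This is the statement that the Friedl–Tillmann polytope of ⟨a,b | R⟩ is a straight line, possibly a single point, if and only if some shortest element of the Aut-orbit of R lies in ⟨a, b⁻¹ab⟩.) -/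
open Pointwise

/-- The free group `F(a,b)` on two generators. -/
abbrev F : Type := FreeGroup (Fin 2)

/-- The generator `a` of `F(a,b)`. -/
def a : F := FreeGroup.of 0

/-- The generator `b` of `F(a,b)`. -/
def b : F := FreeGroup.of 1

/-- The subgroup `⟨a, b⁻¹ab⟩` of `F(a,b)`. -/
def H : Subgroup F := Subgroup.closure {a, b⁻¹ * a * b}

/-- The exponent sum of `a` in a word over `{a, a⁻¹, b, b⁻¹}`. -/
def aSum (w : List (Fin 2 × Bool)) : ℤ :=
  (w.map fun l => if l.1 = 0 then (if l.2 then (1 : ℤ) else -1) else 0).sum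

/-- The exponent sum of `b` in a word over `{a, a⁻¹, b, b⁻¹}`. -/
def bSum (w : List (Fin 2 × Bool)) : ℤ :=
  (w.map fun l => if l.1 = 1 then (if l.2 then (1 : ℤ) else -1) else 0).sum

/-- `W` is cyclically reduced: its reduced word has minimal length among conjugates. -/
def IsCyclicallyReduced (W : F) : Prop :=
  ∀ g : F, FreeGroup.norm W ≤ FreeGroup.norm (g * W * g⁻¹)

/-- The trace of `W`: the images in `ℝ²` of all prefixes of the reduced word of `W`
under `a ↦ (1,0)`, `b ↦ (0,1)`. -/
def trace (W : F) : Set (ℝ × ℝ) :=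
  {p | ∃ u : List (Fin 2 × Bool), u <+: W.toWord ∧ p = ((aSum u : ℝ), (bSum u : ℝ))}

/-- The unit square `[0,1] × [0,1] ⊆ ℝ²`. -/
def unitSquare : Set (ℝ × ℝ) := Set.Icc (0 : ℝ) 1 ×ˢ Set.Icc (0 : ℝ) 1

namespace TwoGen

open FreeGroup

/-- Words in the letters `a, a⁻¹, b, b⁻¹`. -/
abbrev Word : Type := List (Fin 2 × Bool)

/-- Two consecutive letters of a reduced word. -/
abbrev Compat (l l' : Fin 2 × Bool) : Prop := l.1 = l'.1 → l.2 = l'.2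

theorem isReduced_append_iff {u v : Word} :
    IsReduced (u ++ v) ↔ IsReduced u ∧ IsReduced v ∧
      ∀ x ∈ u.getLast?, ∀ y ∈ v.head?, Compat x y :=
  List.isChain_append

theorem isCyclicallyReduced_append_comm {u v : Word}
    (h : FreeGroup.IsCyclicallyReduced (u ++ v)) :
    FreeGroup.IsCyclicallyReduced (v ++ u) := by
  rcases eq_or_ne u [] with rfl | hu
  · simpa using h
  rcases eq_or_ne v [] with rfl | hv
  · simpa using h
  obtain ⟨h1, h2⟩ := h
  obtain ⟨hu1, hv1, huv⟩ := isReduced_append_iff.1 h1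
  rw [List.getLast?_append_of_ne_nil _ hv, List.head?_append_of_ne_nil _ hu] at h2
  refine ⟨isReduced_append_iff.2 ⟨hv1, hu1, h2⟩, ?_⟩
  rw [List.getLast?_append_of_ne_nil _ hu, List.head?_append_of_ne_nil _ hv]
  exact huv

theorem isConj_mk_append_comm (u v : Word) :
    IsConj (FreeGroup.mk (u ++ v)) (FreeGroup.mk (v ++ u)) := by
  rw [isConj_iff]
  exact ⟨(FreeGroup.mk u)⁻¹, by simp only [← FreeGroup.mul_mk]; group⟩

/-- Conjugate cyclically reduced words are cyclic rotations of each other. -/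
theorem isRotated_of_mk_eq_conj {w' : Word} (hw' : FreeGroup.IsCyclicallyReduced w') (u : Word) :
    IsReduced u → ∀ w : Word, FreeGroup.IsCyclicallyReduced w →
      FreeGroup.mk w' = FreeGroup.mk u * FreeGroup.mk w * (FreeGroup.mk u)⁻¹ → w ~r w' := by
  induction u using List.reverseRecOn with
  | nil =>
    intro _ w hw h
    have h' : FreeGroup.mk w' = FreeGroup.mk w := by
      rw [h, ← FreeGroup.one_eq_mk]; group
    have := congrArg FreeGroup.toWord h'
    rw [toWord_mk, toWord_mk, hw'.1.reduce_eq, hw.1.reduce_eq] at this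
    rw [this]
  | append_singleton u x ih =>
    intro hu w hw h
    have hux := isReduced_append_iff.1 hu
    by_cases h1 : ∃ t, w = (x.1, !x.2) :: t
    · obtain ⟨t, rfl⟩ := h1
      have hw2 : FreeGroup.IsCyclicallyReduced (t ++ [(x.1, !x.2)]) :=
        isCyclicallyReduced_append_comm (u := [(x.1, !x.2)]) hw
      have := ih hux.1 _ hw2 (by
        have e : (FreeGroup.mk [(x.1, !x.2)] : F) = (FreeGroup.mk [x])⁻¹ := by
          simp [FreeGroup.inv_mk, FreeGroup.invRev]
        rw [h, ← List.singleton_append (l := t)]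
        simp only [← FreeGroup.mul_mk, e]; group)
      exact (List.IsRotated.symm ⟨t.length, by simp⟩ :
        (x.1, !x.2) :: t ~r t ++ [(x.1, !x.2)]).trans this
    by_cases h2 : ∃ t, w = t ++ [x]
    · obtain ⟨t, rfl⟩ := h2
      have hw2 : FreeGroup.IsCyclicallyReduced ([x] ++ t) := isCyclicallyReduced_append_comm hw
      have := ih hux.1 _ hw2 (by
        rw [h]
        simp only [← FreeGroup.mul_mk]; group)
      exact List.IsRotated.trans (⟨t.length, by simp⟩ : t ++ [x] ~r [x] ++ t) this
    rcases eq_or_ne w [] with rfl | hne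
    · have h3 : FreeGroup.mk w' = 1 := by rw [h, ← FreeGroup.one_eq_mk]; group
      rw [← toWord_eq_nil_iff, toWord_mk, hw'.1.reduce_eq] at h3
      rw [h3]
    exfalso
    have hlast : ∀ y ∈ (u ++ [x]).getLast?, ∀ z ∈ w.head?, Compat y z := by
      intro y hy z hz hyz
      simp only [List.getLast?_concat, Option.mem_def, Option.some.injEq] at hy
      subst hy
      by_contra hne'
      obtain ⟨t, rfl⟩ : ∃ t, w = z :: t := ⟨w.tail, (List.cons_head?_tail hz).symm⟩
      apply h1
      refine ⟨t, ?_⟩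
      congr 1
      ext
      · simp [hyz]
      · cases h3 : x.2 <;> cases h4 : z.2 <;> simp_all
    have hred : IsReduced ((u ++ [x]) ++ w) := isReduced_append_iff.2 ⟨hu, hw.1, hlast⟩
    have hinv : IsReduced (FreeGroup.invRev (u ++ [x])) := by
      rw [isReduced_iff_reduce_eq, reduce_invRev, hu.reduce_eq]
    have hred2 : IsReduced (((u ++ [x]) ++ w) ++ FreeGroup.invRev (u ++ [x])) := by
      refine isReduced_append_iff.2 ⟨hred, hinv, ?_⟩
      rw [List.getLast?_append_of_ne_nil _ hne]
      intro y hy z hz hyz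
      simp only [FreeGroup.invRev, List.map_append, List.map_cons, List.map_nil,
        List.reverse_append, List.reverse_cons, List.reverse_nil, List.nil_append,
        List.singleton_append, List.head?_cons, Option.mem_def, Option.some.injEq] at hz
      by_contra hne'
      apply h2
      refine ⟨w.dropLast, ?_⟩
      have := List.dropLast_append_getLast? y hy
      subst hz
      have e : x = y := by
        ext
        · simpa using congrArg Fin.val hyz.symm
        · cases h3 : x.2 <;> cases h4 : y.2 <;> simp_all
      rw [e, this]
    have key : w' = ((u ++ [x]) ++ w) ++ FreeGroup.invRev (u ++ [x]) := by
      rw [← hw'.1.reduce_eq, ← hred2.reduce_eq, ← toWord_mk, ← toWord_mk, h, FreeGroup.inv_mk]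
      simp only [← FreeGroup.mul_mk]
    obtain ⟨y, t, hyt⟩ : ∃ y t, u ++ [x] = y :: t := by
      cases u <;> simp
    have := hw'.2
    rw [key, hyt, show y :: t ++ w ++ FreeGroup.invRev (y :: t) =
      (y :: t ++ w ++ FreeGroup.invRev t) ++ [(y.1, !y.2)] by simp [FreeGroup.invRev]] at this
    have := this (y.1, !y.2) (by rw [List.getLast?_concat]; rfl) y (by simp) rfl
    simp at this

/-- `w` is a cyclically reduced word representing the conjugacy class of `W`. -/
def IsRep (W : F) (w : Word) : Prop :=
  FreeGroup.IsCyclicallyReduced w ∧ IsConj W (FreeGroup.mk w)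

theorem isRep_reduceCyclically (W : F) : IsRep W (reduceCyclically W.toWord) := by
  refine ⟨reduceCyclically.isCyclicallyReduced isReduced_toWord, ?_⟩
  have h := reduceCyclically.conj_conjugator_reduceCyclically W.toWord
  have h2 : W = FreeGroup.mk (reduceCyclically.conjugator W.toWord) *
      FreeGroup.mk (reduceCyclically W.toWord) *
      (FreeGroup.mk (reduceCyclically.conjugator W.toWord))⁻¹ := by
    rw [FreeGroup.inv_mk, FreeGroup.mul_mk, FreeGroup.mul_mk, h, mk_toWord]
  exact (isConj_iff.2 ⟨_, h2.symm⟩).symm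

theorem exists_isRep (W : F) : ∃ w, IsRep W w := ⟨_, isRep_reduceCyclically W⟩

theorem IsRep.isRotated {W : F} {w w' : Word} (h : IsRep W w) (h' : IsRep W w') : w ~r w' := by
  obtain ⟨g, hg⟩ := isConj_iff.1 (h.2.symm.trans h'.2)
  exact isRotated_of_mk_eq_conj h'.1 g.toWord isReduced_toWord w h.1 (by rw [mk_toWord, hg])

theorem IsRep.append_comm {W : F} {u v : Word} (h : IsRep W (u ++ v)) : IsRep W (v ++ u) :=
  ⟨isCyclicallyReduced_append_comm h.1, h.2.trans (isConj_mk_append_comm u v)⟩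

theorem IsRep.conj {W W' : F} {w : Word} (h : IsRep W w) (hW : IsConj W' W) : IsRep W' w :=
  ⟨h.1, hW.trans h.2⟩

theorem IsRep.ne_nil {W : F} {w : Word} (h : IsRep W w) (hW : W ≠ 1) : w ≠ [] := by
  rintro rfl
  have h2 := h.2
  rw [← FreeGroup.one_eq_mk, isConj_one_left] at h2
  exact hW h2

/-- The number of letters with index `i` in a word. -/
def cnt (i : Fin 2) (w : Word) : ℕ := w.countP (·.1 = i)

theorem cnt_append (i : Fin 2) (u v : Word) : cnt i (u ++ v) = cnt i u + cnt i v :=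
  List.countP_append

theorem cnt_zero_add_cnt_one (w : Word) : cnt 0 w + cnt 1 w = w.length := by
  induction w with
  | nil => rfl
  | cons l w ih =>
    obtain ⟨i, s⟩ := l
    simp only [cnt, List.countP_cons, List.length_cons] at *
    fin_cases i <;> simp <;> omega

/-- The number of letters with index `i` in the cyclically reduced words representing the
conjugacy class of `W`. -/
def num (i : Fin 2) (W : F) : ℕ := cnt i (reduceCyclically W.toWord)

theorem IsRep.cnt_eq {W : F} {w w' : Word} (h : IsRep W w) (h' : IsRep W w') (i : Fin 2) :
    cnt i w = cnt i w' :=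
  (h.isRotated h').perm.countP_eq _

theorem IsRep.num_eq {W : F} {w : Word} (h : IsRep W w) (i : Fin 2) : num i W = cnt i w :=
  (isRep_reduceCyclically W).cnt_eq h i

theorem num_conj {W W' : F} (h : IsConj W W') (i : Fin 2) : num i W = num i W' := by
  obtain ⟨w, hw⟩ := exists_isRep W'
  rw [hw.num_eq, (hw.conj h).num_eq]

theorem num_add_num_le_norm (W : F) : num 0 W + num 1 W ≤ FreeGroup.norm W := by
  rw [num, num, cnt_zero_add_cnt_one, FreeGroup.norm]
  conv_rhs => rw [← reduceCyclically.conj_conjugator_reduceCyclically W.toWord]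
  simp only [List.length_append]
  omega

theorem IsRep.norm_mk {W : F} {w : Word} (h : IsRep W w) :
    FreeGroup.norm (FreeGroup.mk w) = num 0 W + num 1 W := by
  rw [h.num_eq, h.num_eq, cnt_zero_add_cnt_one, FreeGroup.norm, toWord_mk, h.1.1.reduce_eq]

/-- An element of minimal length in its conjugacy class has a cyclically reduced word. -/
theorem isRep_toWord {W : F} (h : _root_.IsCyclicallyReduced W) : IsRep W W.toWord := by
  have e := reduceCyclically.conj_conjugator_reduceCyclically W.toWord
  obtain ⟨w, hw⟩ := exists_isRep W
  obtain ⟨g, hg⟩ := isConj_iff.1 hw.2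
  have h1 := h g
  rw [hg, hw.norm_mk, num, num, cnt_zero_add_cnt_one, FreeGroup.norm] at h1
  have h2 := congrArg List.length e
  simp only [List.length_append, FreeGroup.invRev_length] at h2
  have h3 : reduceCyclically.conjugator W.toWord = [] := by
    rw [← List.length_eq_zero_iff]; omega
  rw [h3] at e
  simp only [FreeGroup.invRev_empty, List.nil_append, List.append_nil] at e
  refine ⟨?_, by rw [mk_toWord]⟩
  rw [← e]
  exact reduceCyclically.isCyclicallyReduced isReduced_toWord

theorem hom_ext {G : Type*} [Group G] {f g : F →* G} (ha : f a = g a) (hb : f b = g b) :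
    f = g := by
  ext i
  fin_cases i
  · exact ha
  · exact hb

/-- The endomorphism `a ↦ x`, `b ↦ y`. -/
def endo (x y : F) : F →* F := FreeGroup.lift ![x, y]

@[simp] theorem endo_a (x y : F) : endo x y a = x := by simp [endo, a]
@[simp] theorem endo_b (x y : F) : endo x y b = y := by simp [endo, b]

/-- The automorphism `a ↦ x`, `b ↦ y`, given the inverse `a ↦ x'`, `b ↦ y'`. -/
def autOf (x y x' y' : F) (h1 : endo x' y' x = a) (h2 : endo x' y' y = b)
    (h3 : endo x y x' = a) (h4 : endo x y y' = b) : F ≃* F :=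
  MonoidHom.toMulEquiv (endo x y) (endo x' y')
    (hom_ext (by simpa using h1) (by simpa using h2))
    (hom_ext (by simpa using h3) (by simpa using h4))

/-- The transvection `a ↦ a b ^ j`, `b ↦ b`. -/
def tv (j : ℤ) : F ≃* F :=
  autOf (a * b ^ j) b (a * b ^ (-j)) b (by simp) (by simp) (by simp) (by simp)

/-- The automorphism exchanging `a` and `b`. -/
def sw : F ≃* F := autOf b a b a (by simp) (by simp) (by simp) (by simp)

/-- The automorphism `a ↦ a⁻¹`, `b ↦ b`. -/
def fa : F ≃* F := autOf a⁻¹ b a⁻¹ b (by simp) (by simp) (by simp) (by simp)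

/-- The automorphism `a ↦ a`, `b ↦ b⁻¹`. -/
def fb : F ≃* F := autOf a b⁻¹ a b⁻¹ (by simp) (by simp) (by simp) (by simp)

@[simp] theorem tv_a (j : ℤ) : tv j a = a * b ^ j := endo_a (a * b ^ j) b
@[simp] theorem tv_b (j : ℤ) : tv j b = b := endo_b (a * b ^ j) b
@[simp] theorem sw_a : sw a = b := endo_a b a
@[simp] theorem sw_b : sw b = a := endo_b b a
@[simp] theorem fa_a : fa a = a⁻¹ := endo_a (a⁻¹) b
@[simp] theorem fa_b : fa b = b := endo_b (a⁻¹) b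
@[simp] theorem fb_a : fb a = a := endo_a a (b⁻¹)
@[simp] theorem fb_b : fb b = b⁻¹ := endo_b a (b⁻¹)

theorem aut_ext {α β : F ≃* F} (ha : α a = β a) (hb : α b = β b) : α = β := by
  have : (α : F →* F) = (β : F →* F) := hom_ext (by simpa using ha) (by simpa using hb)
  ext x
  exact DFunLike.congr_fun this x

theorem aut_apply_eq {α β : MulAut F} (ha : α a = β a) (hb : α b = β b) (x : F) : α x = β x := by
  rw [aut_ext ha hb]

theorem tv_tv (i j : ℤ) (x : F) : tv i (tv j x) = tv (i + j) x :=
  aut_apply_eq (α := tv i * tv j) (by simp [mul_assoc, zpow_add]) (by simp) x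

@[simp] theorem tv_zero (x : F) : tv 0 x = x :=
  aut_apply_eq (β := 1) (by simp) (by simp) x

@[simp] theorem sw_sw (x : F) : sw (sw x) = x :=
  aut_apply_eq (α := sw * sw) (β := 1) (by simp) (by simp) x

@[simp] theorem fb_fb (x : F) : fb (fb x) = x :=
  aut_apply_eq (α := fb * fb) (β := 1) (by simp) (by simp) x

theorem sw_fa_sw (x : F) : sw (fa (sw x)) = fb x :=
  aut_apply_eq (α := sw * fa * sw) (β := fb) (by simp) (by simp) x

theorem fb_tv_fb (j : ℤ) (x : F) : fb (tv j (fb x)) = tv (-j) x :=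
  aut_apply_eq (α := fb * tv j * fb) (β := tv (-j)) (by simp) (by simp) x

theorem isConj_map (α : F ≃* F) {x y : F} (h : IsConj x y) : IsConj (α x) (α y) := by
  obtain ⟨c, hc⟩ := isConj_iff.1 h
  exact isConj_iff.2 ⟨α c, by rw [← hc]; simp⟩

/-- If two automorphisms agree on generators up to a common conjugation, they agree up to
conjugation. -/
theorem isConj_of_gen {α β : MulAut F} (g : F) (ha : α a = g * β a * g⁻¹)
    (hb : α b = g * β b * g⁻¹) (x : F) : IsConj (β x) (α x) := by
  refine isConj_iff.2 ⟨g, ?_⟩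
  have := aut_apply_eq (α := α) (β := MulAut.conj g * β) (by simpa using ha) (by simpa using hb) x
  rw [this]; simp

/-- A letter permutation compatible with inversion. -/
structure IsLetterMap (σ : F ≃* F) (m : Fin 2 × Bool → Fin 2 × Bool) : Prop where
  mk_eq : ∀ l, σ (FreeGroup.mk [l]) = FreeGroup.mk [m l]
  compat : ∀ l l', Compat l l' → Compat (m l) (m l')

theorem IsLetterMap.map_mk {σ : F ≃* F} {m} (h : IsLetterMap σ m) (w : Word) :
    σ (FreeGroup.mk w) = FreeGroup.mk (w.map m) := by
  induction w with
  | nil => rw [← FreeGroup.one_eq_mk, _root_.map_one]; rfl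
  | cons l w ih =>
    rw [← List.singleton_append, ← FreeGroup.mul_mk, _root_.map_mul, ih, h.mk_eq, FreeGroup.mul_mk]
    rfl

theorem IsLetterMap.isRep {σ : F ≃* F} {m} (h : IsLetterMap σ m) {W : F} {w : Word}
    (hw : IsRep W w) : IsRep (σ W) (w.map m) := by
  refine ⟨⟨?_, ?_⟩, ?_⟩
  · exact List.isChain_map_of_isChain m (fun x y hxy => h.compat x y hxy) hw.1.1
  · intro x hx y hy
    simp only [List.getLast?_map, List.head?_map, Option.mem_def, Option.map_eq_some_iff] at hx hy
    obtain ⟨x, hx, rfl⟩ := hx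
    obtain ⟨y, hy, rfl⟩ := hy
    exact h.compat x y (hw.1.2 x hx y hy)
  · rw [← h.map_mk]
    exact isConj_map σ hw.2

theorem mk_letter_a (s : Bool) : (FreeGroup.mk [(0, s)] : F) = a ^ (cond s 1 (-1) : ℤ) := by
  cases s <;> simp [a, FreeGroup.of, FreeGroup.inv_mk, FreeGroup.invRev]

theorem mk_letter_b (s : Bool) : (FreeGroup.mk [(1, s)] : F) = b ^ (cond s 1 (-1) : ℤ) := by
  cases s <;> simp [b, FreeGroup.of, FreeGroup.inv_mk, FreeGroup.invRev]

theorem isLetterMap_sw : IsLetterMap sw (fun l => (1 - l.1, l.2)) where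
  mk_eq := by
    rintro ⟨i, s⟩
    fin_cases i <;> simp [mk_letter_a, mk_letter_b]
  compat := by decide

theorem isLetterMap_fa : IsLetterMap fa (fun l => (l.1, if l.1 = 0 then !l.2 else l.2)) where
  mk_eq := by
    rintro ⟨i, s⟩
    fin_cases i <;> cases s <;> simp [mk_letter_a, mk_letter_b]
  compat := by decide

theorem isLetterMap_fb : IsLetterMap fb (fun l => (l.1, if l.1 = 1 then !l.2 else l.2)) where
  mk_eq := by
    rintro ⟨i, s⟩
    fin_cases i <;> cases s <;> simp [mk_letter_a, mk_letter_b]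
  compat := by decide

theorem num_sw (i : Fin 2) (W : F) : num i (sw W) = num (1 - i) W := by
  obtain ⟨w, hw⟩ := exists_isRep W
  rw [(isLetterMap_sw.isRep hw).num_eq, hw.num_eq, cnt, cnt, List.countP_map]
  congr 1
  funext l
  obtain ⟨j, s⟩ := l
  fin_cases i <;> fin_cases j <;> rfl

theorem num_fa (i : Fin 2) (W : F) : num i (fa W) = num i W := by
  obtain ⟨w, hw⟩ := exists_isRep W
  rw [(isLetterMap_fa.isRep hw).num_eq, hw.num_eq, cnt, cnt, List.countP_map]
  rfl

theorem num_fb (i : Fin 2) (W : F) : num i (fb W) = num i W := by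
  obtain ⟨w, hw⟩ := exists_isRep W
  rw [(isLetterMap_fb.isRep hw).num_eq, hw.num_eq, cnt, cnt, List.countP_map]
  rfl

/-- The reduced word of `b ^ k`. -/
def bpow (k : ℤ) : Word := List.replicate k.natAbs (1, decide (0 ≤ k))

/-- The word `a ^ (±1) b ^ (k 0) a ^ (±1) b ^ (k 1) ⋯` with `n` letters `a ^ (±1)`. -/
def blocks (e : ℕ → Bool) (k : ℕ → ℤ) : ℕ → Word
  | 0 => []
  | n + 1 => blocks e k n ++ (0, e n) :: bpow (k n)

theorem mk_bpow (k : ℤ) : FreeGroup.mk (bpow k) = b ^ k := by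
  have key : ∀ (n : ℕ) (s : Bool), (FreeGroup.mk (List.replicate n ((1 : Fin 2), s)) : F) =
      b ^ ((n : ℤ) * cond s 1 (-1)) := by
    intro n s
    induction n with
    | zero => simp [← FreeGroup.one_eq_mk]
    | succ n ih =>
      rw [List.replicate_succ, ← List.singleton_append, ← FreeGroup.mul_mk, ih, mk_letter_b,
        ← zpow_add]
      congr 1
      push_cast
      ring
  rw [bpow, key]
  congr 1
  rcases le_or_gt 0 k with h | h
  · simp [h, abs_of_nonneg h]
  · simp [not_le.2 h, abs_of_neg h]

theorem isReduced_bpow (k : ℤ) : IsReduced (bpow k) :=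
  List.isChain_replicate_of_rel _ (fun _ => rfl)

theorem bpow_eq_nil {k : ℤ} : bpow k = [] ↔ k = 0 := by simp [bpow]

theorem getLast?_letter_bpow (s : Bool) (k : ℤ) :
    (((0 : Fin 2), s) :: bpow k).getLast? = some (if k = 0 then (0, s) else (1, decide (0 ≤ k))) := by
  by_cases h : k = 0
  · simp [h, bpow]
  · have : bpow k ≠ [] := by simpa [bpow_eq_nil] using h
    rw [← List.singleton_append, List.getLast?_append_of_ne_nil _ this, bpow,
      List.getLast?_replicate]
    simp [h]

theorem blocks_getLast? (e : ℕ → Bool) (k : ℕ → ℤ) (n : ℕ) :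
    (blocks e k (n + 1)).getLast? =
      some (if k n = 0 then (0, e n) else (1, decide (0 ≤ k n))) := by
  rw [blocks, List.getLast?_append_of_ne_nil _ (by simp), getLast?_letter_bpow]

theorem blocks_head? (e : ℕ → Bool) (k : ℕ → ℤ) (n : ℕ) :
    (blocks e k (n + 1)).head? = some (0, e 0) := by
  induction n with
  | zero => simp [blocks]
  | succ n ih =>
    rw [blocks, List.head?_append, ih]
    rfl

theorem isReduced_blocks {e : ℕ → Bool} {k : ℕ → ℤ} {n : ℕ}
    (h : ∀ i, i + 1 < n → k i = 0 → e i = e (i + 1)) : IsReduced (blocks e k n) := by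
  induction n with
  | zero => simp [blocks]
  | succ n ih =>
    refine isReduced_append_iff.2 ⟨ih fun i hi => h i (by omega), ?_, ?_⟩
    · rw [← List.singleton_append]
      refine isReduced_append_iff.2 ⟨by simp, isReduced_bpow _, ?_⟩
      intro x hx y hy hxy
      have := List.mem_of_mem_head? hy
      simp only [bpow, List.mem_replicate] at this
      simp at hx
      subst hx
      rw [this.2] at hxy
      simp at hxy
    · intro x hx y hy hxy
      cases n with
      | zero => simp [blocks] at hx
      | succ n =>
        rw [blocks_getLast?] at hx
        simp only [Option.mem_def, Option.some.injEq, List.head?_cons] at hx hy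
        subst hx hy
        split_ifs at hxy ⊢ with h0
        · exact h n (by omega) h0
        · simp at hxy

/-- Cyclically reduced block data: `e` describes the signs of the `a`-letters and is read
cyclically through `e n = e 0`, `k` the exponents of `b` between them. -/
structure IsBlock (e : ℕ → Bool) (k : ℕ → ℤ) (n : ℕ) : Prop where
  pos : 0 < n
  closed : e n = e 0
  reduced : ∀ i < n, k i = 0 → e i = e (i + 1)

theorem IsBlock.isCyclicallyReduced {e : ℕ → Bool} {k : ℕ → ℤ} {n : ℕ} (h : IsBlock e k n) :
    FreeGroup.IsCyclicallyReduced (blocks e k n) := by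
  refine ⟨isReduced_blocks fun i hi => h.reduced i (by omega), ?_⟩
  obtain ⟨n, rfl⟩ := Nat.exists_eq_add_one_of_ne_zero h.pos.ne'
  rw [blocks_getLast?, blocks_head?]
  intro x hx y hy hxy
  simp only [Option.mem_def, Option.some.injEq] at hx hy
  subst hx hy
  split_ifs at hxy ⊢ with h0
  · exact (h.reduced n (by omega) h0).trans h.closed
  · simp at hxy

theorem blocks_congr {e e' : ℕ → Bool} {k k' : ℕ → ℤ} {n : ℕ} (he : ∀ i < n, e i = e' i)
    (hk : ∀ i < n, k i = k' i) : blocks e k n = blocks e' k' n := by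
  induction n with
  | zero => rfl
  | succ n ih =>
    rw [blocks, blocks, ih (fun i hi => he i (by omega)) (fun i hi => hk i (by omega)),
      he n (by omega), hk n (by omega)]

theorem bpow_append {k : ℤ} {s : Bool} (h : k = 0 ∨ decide (0 ≤ k) = s) :
    bpow k ++ [(1, s)] = bpow (k + cond s 1 (-1)) := by
  have e : ∀ n : ℕ, List.replicate n ((1 : Fin 2), s) ++ [(1, s)] = List.replicate (n + 1) (1, s) :=
    fun n => (List.replicate_succ').symm
  cases s
  · have hk : k ≤ 0 := by
      rcases h with h | h
      · omega
      · simp at h; omega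
    have : bpow k = List.replicate k.natAbs (1, false) := by
      rcases hk.eq_or_lt with rfl | hk
      · rfl
      · simp [bpow, hk]
    have h2 : ¬ (0 ≤ k + -1) := by omega
    rw [this, e]
    simp only [bpow, cond_false, h2, decide_false]
    congr 1
    omega
  · have hk : 0 ≤ k := by
      rcases h with h | h
      · omega
      · simpa using h
    have h2 : 0 ≤ k + 1 := by omega
    simp only [bpow, cond_true, h2, hk, decide_true, e]
    congr 1
    omega

/-- Every reduced word starting with `a ^ (±1)` is a product of blocks. -/
theorem exists_blocks (w : Word) (hw : IsReduced w) (hne : w ≠ [])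
    (h0 : ∀ x ∈ w.head?, x.1 = 0) :
    ∃ (n : ℕ) (e : ℕ → Bool) (k : ℕ → ℤ), 0 < n ∧ w = blocks e k n ∧
      ∀ i, i + 1 < n → k i = 0 → e i = e (i + 1) := by
  induction w using List.reverseRecOn with
  | nil => exact absurd rfl hne
  | append_singleton w x ih =>
    rcases eq_or_ne w [] with rfl | hne'
    · have := h0 x (by simp)
      refine ⟨1, fun _ => x.2, fun _ => 0, one_pos, ?_, by simp⟩
      simp [blocks, bpow, ← this]
    obtain ⟨hw1, -, hwx⟩ := isReduced_append_iff.1 hw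
    obtain ⟨n, e, k, hn, rfl, hek⟩ := ih hw1 hne'
      (by rwa [List.head?_append_of_ne_nil _ hne'] at h0)
    obtain ⟨n, rfl⟩ := Nat.exists_eq_add_one_of_ne_zero hn.ne'
    have hl := hwx _ (blocks_getLast? e k n) x (by simp)
    obtain ⟨i, s⟩ := x
    fin_cases i
    · refine ⟨n + 2, Function.update e (n + 1) s, Function.update k (n + 1) 0, by omega, ?_, ?_⟩
      · rw [show ∀ e' k', blocks e' k' (n + 2) =
          blocks e' k' (n + 1) ++ (0, e' (n + 1)) :: bpow (k' (n + 1)) from fun _ _ => rfl,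
          Function.update_self, Function.update_self]
        change _ ++ [(0, s)] = _
        congr 1
        exact blocks_congr (fun i hi => by rw [Function.update_of_ne (by omega)])
          (fun i hi => by rw [Function.update_of_ne (by omega)])
      · intro i hi
        rw [Function.update_of_ne (by omega), Function.update_of_ne (by omega)]
        intro hki
        rcases (show i ≤ n by omega).eq_or_lt with rfl | hi'
        · rw [Function.update_self]
          simpa [hki, Compat] using hl
        · rw [Function.update_of_ne (by omega)]
          exact hek i (by omega) hki
    · have hs : k n = 0 ∨ decide (0 ≤ k n) = s := by
        by_cases hk : k n = 0
        · exact Or.inl hk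
        · right
          simpa [hk, Compat] using hl
      refine ⟨n + 1, e, Function.update k n (k n + cond s 1 (-1)), by omega, ?_, ?_⟩
      · rw [blocks, blocks, Function.update_self, ← bpow_append hs]
        change _ ++ [(1, s)] = _
        simp only [List.append_assoc, List.cons_append]
        congr 1
        exact blocks_congr (fun i hi => rfl) (fun i hi => by rw [Function.update_of_ne (by omega)])
      · intro i hi
        rw [Function.update_of_ne (by omega)]
        exact hek i hi

/-- A conjugacy class in which the letter `a` occurs is represented by block data. -/
theorem exists_isBlock {W : F} (hW : 0 < num 0 W) :
    ∃ (n : ℕ) (e : ℕ → Bool) (k : ℕ → ℤ), IsBlock e k n ∧ IsRep W (blocks e k n) := by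
  obtain ⟨w, hw⟩ := exists_isRep W
  rw [hw.num_eq, cnt, List.countP_pos_iff] at hW
  obtain ⟨x, hx, hx0⟩ := hW
  obtain ⟨u, v, rfl⟩ := List.append_of_mem hx
  have hw' := hw.append_comm
  obtain ⟨n, e, k, hn, he, hek⟩ := exists_blocks _ hw'.1.1 (by simp) (by simpa using hx0)
  rw [he] at hw'
  have heq : ∀ i < n, Function.update e n (e 0) i = e i := fun i hi =>
    Function.update_of_ne (by omega) _ _
  have hb : blocks (Function.update e n (e 0)) k n = blocks e k n :=
    blocks_congr heq fun _ _ => rfl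
  refine ⟨n, Function.update e n (e 0), k, ⟨hn, ?_, ?_⟩, by rwa [hb]⟩
  · rw [Function.update_self, heq 0 hn]
  · intro i hi hk
    rw [heq i hi]
    by_cases hi' : i + 1 < n
    · rw [heq _ hi']
      exact hek i hi' hk
    · obtain rfl : n = i + 1 := by omega
      rw [Function.update_self]
      have h2 := hw'.1.2
      rw [blocks_getLast?, blocks_head?] at h2
      simpa [hk] using h2

theorem cnt_zero_blocks (e : ℕ → Bool) (k : ℕ → ℤ) (n : ℕ) : cnt 0 (blocks e k n) = n := by
  induction n with
  | zero => rfl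
  | succ n ih =>
    rw [blocks, cnt_append, ih]
    simp [cnt, bpow, List.countP_replicate]

theorem cnt_one_blocks (e : ℕ → Bool) (k : ℕ → ℤ) (n : ℕ) :
    cnt 1 (blocks e k n) = ∑ i ∈ Finset.range n, (k i).natAbs := by
  induction n with
  | zero => rfl
  | succ n ih =>
    rw [blocks, cnt_append, ih, Finset.sum_range_succ]
    simp [cnt, bpow, List.countP_replicate]

/-- The change of the `i`-th exponent of `b` under the transvection `a ↦ a b`. -/
def slope (e : ℕ → Bool) (i : ℕ) : ℤ := cond (e i) 1 0 - cond (e (i + 1)) 0 1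

theorem tv_mk_blocks (j : ℤ) (e : ℕ → Bool) (k : ℕ → ℤ) (n : ℕ) :
    tv j (FreeGroup.mk (blocks e k n)) = b ^ (-(j * cond (e 0) 0 1)) *
      FreeGroup.mk (blocks e (fun i => k i + j * slope e i) n) * b ^ (j * cond (e n) 0 1) := by
  induction n with
  | zero => simp [blocks, ← FreeGroup.one_eq_mk]
  | succ n ih =>
    rw [blocks, blocks, ← FreeGroup.mul_mk, _root_.map_mul, ih, ← FreeGroup.mul_mk,
      ← List.singleton_append, ← List.singleton_append (l := bpow _), ← FreeGroup.mul_mk,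
      ← FreeGroup.mul_mk, mk_bpow, mk_bpow, mk_letter_a, _root_.map_mul, map_zpow, map_zpow,
      tv_a, tv_b]
    rcases h1 : e n <;> rcases h2 : e (n + 1) <;> simp [slope, h1, h2, mul_assoc, ← zpow_add] <;> 
      ring_nf

theorem IsBlock.tv {e : ℕ → Bool} {k : ℕ → ℤ} {n : ℕ} (h : IsBlock e k n) (j : ℤ) :
    IsBlock e (fun i => k i + j * slope e i) n := by
  refine ⟨h.pos, h.closed, fun i hi hk => ?_⟩
  have := h.reduced i hi
  rcases h1 : e i <;> rcases h2 : e (i + 1) <;> simp_all [slope]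

theorem isRep_tv {W : F} {e : ℕ → Bool} {k : ℕ → ℤ} {n : ℕ} (h : IsBlock e k n)
    (hW : IsRep W (blocks e k n)) (j : ℤ) :
    IsRep (tv j W) (blocks e (fun i => k i + j * slope e i) n) := by
  refine ⟨(h.tv j).isCyclicallyReduced, (isConj_map (TwoGen.tv j) hW.2).trans ?_⟩
  rw [tv_mk_blocks, h.closed, isConj_iff]
  exact ⟨b ^ (j * cond (e 0) 0 1), by group⟩

/-- The letter counts along a family of transvections. -/
theorem exists_num_tv {W : F} (hW : 0 < num 0 W) :
    ∃ k s : ℕ → ℤ, (∀ j, num 0 (tv j W) = num 0 W) ∧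
      (∀ j, num 1 (tv j W) = ∑ i ∈ Finset.range (num 0 W), (k i + j * s i).natAbs) ∧
      ∀ i < num 0 W, s i = 0 → k i ≠ 0 := by
  obtain ⟨n, e, k, hb, hr⟩ := exists_isBlock hW
  have hn : num 0 W = n := by rw [hr.num_eq, cnt_zero_blocks]
  refine ⟨k, slope e, fun j => ?_, fun j => ?_, fun i hi hs hk => ?_⟩
  · rw [(isRep_tv hb hr j).num_eq, cnt_zero_blocks, hn]
  · rw [(isRep_tv hb hr j).num_eq, cnt_one_blocks, hn]
  · have := hb.reduced i (hn ▸ hi) hk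
    rw [slope, ← this] at hs
    cases h : e i <;> simp [h] at hs

theorem num_zero_tv {W : F} (hW : 0 < num 0 W) (j : ℤ) : num 0 (tv j W) = num 0 W := by
  obtain ⟨k, s, h, -⟩ := exists_num_tv hW
  exact h j

/-- Convexity of the number of `b`-letters along a family of transvections. -/
theorem two_mul_num_one_le {W : F} (hW : 0 < num 0 W) :
    2 * num 1 (tv 1 W) ≤ num 1 W + num 1 (tv 1 (tv 1 W)) := by
  obtain ⟨k, s, -, h, -⟩ := exists_num_tv hW
  have h0 := h 0
  rw [tv_zero] at h0
  rw [tv_tv, h0, h, h, Finset.mul_sum, ← Finset.sum_add_distrib]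
  exact Finset.sum_le_sum fun i _ => by simp; omega

/-- The letter `a` occurs in every element of the automorphism orbit of `W`, up to conjugation. -/
def Full (W : F) : Prop := ∀ α : F ≃* F, 0 < num 0 (α W)

theorem Full.map {W : F} (h : Full W) (α : F ≃* F) : Full (α W) := fun β => h (α.trans β)

theorem Full.num_pos {W : F} (h : Full W) (i : Fin 2) : 0 < num i W := by
  fin_cases i
  · exact h (MulEquiv.refl F)
  · have := h sw
    rwa [num_sw] at this

/-- The exponent sum of `b`. -/
def bExp : F →* Multiplicative ℤ := FreeGroup.lift ![1, Multiplicative.ofAdd 1]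

theorem bExp_b : bExp b = Multiplicative.ofAdd 1 := by simp [bExp, b]

theorem mem_zpowers_of_cnt_eq_zero (w : Word) (h : cnt 0 w = 0) : ∃ k : ℤ, FreeGroup.mk w = b ^ k := by
  induction w with
  | nil => exact ⟨0, by simp [← FreeGroup.one_eq_mk]⟩
  | cons l w ih =>
    obtain ⟨i, s⟩ := l
    rw [← List.singleton_append, cnt_append, Nat.add_eq_zero_iff] at h
    obtain ⟨k, hk⟩ := ih h.2
    rw [← List.singleton_append, ← FreeGroup.mul_mk, hk]
    fin_cases i
    · simp [cnt] at h
    · exact ⟨_, by rw [Fin.mk_one, mk_letter_b, ← zpow_add]⟩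

theorem map_mem_commutator (α : F ≃* F) {W : F} (h : W ∈ commutator F) : α W ∈ commutator F :=
  Subgroup.characteristic_iff_le_comap.1 inferInstance α h

theorem full_of_mem_commutator {W : F} (hW : W ∈ commutator F) (h1 : W ≠ 1) : Full W := by
  intro α
  rw [pos_iff_ne_zero]
  intro h0
  obtain ⟨w, hw⟩ := exists_isRep (α W)
  rw [hw.num_eq] at h0
  obtain ⟨k, hk⟩ := mem_zpowers_of_cnt_eq_zero w h0
  have h2 : bExp (α W) = 1 :=
    (Abelianization.commutator_subset_ker bExp : commutator F ≤ _) (map_mem_commutator α hW)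
  have h3 := isConj_iff_eq.1 (bExp.map_isConj hw.2)
  rw [h2, hk, map_zpow, bExp_b, ← ofAdd_zsmul] at h3
  have h4 : k = 0 := by simpa using (ofAdd_eq_one.1 h3.symm)
  have h5 := hw.2
  rw [hk, h4, zpow_zero, isConj_one_left] at h5
  exact h1 (by simpa using h5)

theorem isConj_tv_fa (j : ℤ) (x : F) : IsConj (tv j (fa x)) (fa (tv (-j) x)) :=
  isConj_of_gen (α := fa * tv (-j)) (β := tv j * fa) (b ^ j) (by simp)
    (by simp [(Commute.refl b).zpow_left j |>.eq]) x

theorem tv_fb (j : ℤ) (x : F) : tv j (fb x) = fb (tv (-j) x) := by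
  rw [← fb_tv_fb, fb_fb]

theorem sw_fa (x : F) : sw (fa x) = fb (sw x) := by rw [← sw_fa_sw, sw_sw]

theorem sw_fb (x : F) : sw (fb x) = fa (sw x) := by rw [← sw_fa_sw, sw_sw]

theorem num_one_tv_sw {W : F} (hW : Full W) : num 1 (tv 1 (sw W)) = num 1 (tv 1 W) := by
  have key : IsConj (tv 1 (sw W)) (fa (sw (tv (-1) (sw (tv 1 W))))) :=
    isConj_of_gen (α := fa * sw * tv (-1) * sw * tv 1) (β := tv 1 * sw) a⁻¹
      (by simp [mul_assoc]) (by simp) W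
  rw [num_conj key, num_fa, num_sw]
  change num 0 _ = _
  rw [num_zero_tv ((hW.map (tv 1)).map sw |>.num_pos 0), num_sw]
  rfl

/-- The transvection `a ↦ a b` does not decrease the letter counts. -/
def Expands (W : F) : Prop := ∀ i, num i W ≤ num 1 (tv 1 W)

theorem Expands.sw {W : F} (hW : Full W) (h : Expands W) : Expands (sw W) := fun i => by
  rw [num_one_tv_sw hW, num_sw]
  exact h _

theorem Expands.tv {W : F} (hW : Full W) (h : Expands W) : Expands (tv 1 W) := fun i => by
  have h1 := two_mul_num_one_le (hW.num_pos 0)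
  have h2 := h 0
  have h3 := h 1
  fin_cases i
  · change num 0 _ ≤ _
    rw [num_zero_tv (hW.num_pos 0)]
    omega
  · change num 1 _ ≤ _
    omega

/-- `Expands` holds for both transvections `a ↦ a b ^ (±1)`, and the length is `t`. -/
structure IsSeed (t : ℕ) (W : F) : Prop where
  full : Full W
  left : ∀ i, num i W ≤ num 1 (tv 1 W)
  right : ∀ i, num i W ≤ num 1 (tv (-1) W)
  total : num 0 W + num 1 W = t

theorem IsSeed.fb {t : ℕ} {W : F} (h : IsSeed t W) : IsSeed t (fb W) where
  full := h.full.map _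
  left i := by rw [tv_fb, num_fb, num_fb]; exact h.right i
  right i := by rw [tv_fb, num_fb, num_fb, neg_neg]; exact h.left i
  total := by rw [num_fb, num_fb, h.total]

theorem IsSeed.sw {t : ℕ} {W : F} (h : IsSeed t W) : IsSeed t (sw W) where
  full := h.full.map _
  left i := by rw [num_one_tv_sw h.full, num_sw]; exact h.left _
  right i := by
    rw [← fb_tv_fb, num_fb, ← sw_fa, num_one_tv_sw (h.full.map _), num_conj (isConj_tv_fa _ _),
      num_fa, num_sw]
    exact h.right _
  total := by
    rw [num_sw, num_sw, ← h.total]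
    exact add_comm _ _

/-- The elements obtained from seeds by positive automorphisms. -/
inductive Grown (t : ℕ) : F → Prop
  | seed {W} : IsSeed t W → Grown t W
  | tv {W} : Grown t W → Grown t (tv 1 W)
  | sw {W} : Grown t W → Grown t (sw W)

theorem Grown.bounds {t : ℕ} {W : F} (h : Grown t W) :
    Full W ∧ Expands W ∧ t ≤ num 0 W + num 1 W := by
  induction h with
  | seed h => exact ⟨h.full, h.left, h.total.ge⟩
  | @tv W _ ih =>
    obtain ⟨h1, h2, h3⟩ := ih
    refine ⟨h1.map _, h2.tv h1, ?_⟩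
    rw [num_zero_tv (h1.num_pos 0)]
    have := h2 1
    omega
  | @sw W _ ih =>
    obtain ⟨h1, h2, h3⟩ := ih
    refine ⟨h1.map _, h2.sw h1, ?_⟩
    rw [num_sw, num_sw]
    exact h3.trans (add_comm _ _).le

/-- The closure of the grown elements under sign changes and conjugation. -/
inductive Signed (t : ℕ) : F → Prop
  | grown {W} : Grown t W → Signed t W
  | fa {W} : Signed t W → Signed t (fa W)
  | fb {W} : Signed t W → Signed t (fb W)
  | conj {W V} : Signed t W → IsConj V W → Signed t V

theorem Signed.le {t : ℕ} {W : F} (h : Signed t W) : t ≤ num 0 W + num 1 W := by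
  induction h with
  | grown h => exact h.bounds.2.2
  | fa _ ih => rwa [num_fa, num_fa]
  | fb _ ih => rwa [num_fb, num_fb]
  | conj _ hc ih => rwa [num_conj hc, num_conj hc]

theorem Grown.tv_neg {t : ℕ} {W : F} (h : Grown t W) :
    Signed t (TwoGen.tv (-1) W) ∧ Signed t (TwoGen.tv (-1) (TwoGen.sw W)) := by
  have key : ∀ V, IsSeed t V → Signed t (TwoGen.tv (-1) V) := fun V hV => by
    rw [← fb_tv_fb]
    exact (Signed.grown (Grown.seed hV.fb).tv).fb
  induction h with
  | @seed W h => exact ⟨key W h, key _ h.sw⟩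
  | @tv W h ih =>
    constructor
    · rw [tv_tv, neg_add_cancel, tv_zero]
      exact .grown h
    · refine (Signed.grown h.sw.tv.sw).fb.conj ?_
      exact isConj_of_gen (α := TwoGen.fb * TwoGen.sw * TwoGen.tv 1 * TwoGen.sw)
        (β := TwoGen.tv (-1) * TwoGen.sw * TwoGen.tv 1) b⁻¹ (by simp) (by simp [mul_assoc]) W
  | @sw W h ih =>
    rw [sw_sw]
    exact ih.symm

theorem Signed.tv {t : ℕ} {W : F} (h : Signed t W) :
    Signed t (TwoGen.tv 1 W) ∧ Signed t (TwoGen.tv (-1) W) := by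
  induction h with
  | grown h => exact ⟨.grown h.tv, h.tv_neg.1⟩
  | fa _ ih => exact ⟨ih.2.fa.conj (isConj_tv_fa _ _), ih.1.fa.conj (isConj_tv_fa _ _)⟩
  | fb _ ih => exact ⟨by rw [tv_fb]; exact ih.2.fb, by rw [tv_fb]; exact ih.1.fb⟩
  | conj _ hc ih => exact ⟨ih.1.conj (isConj_map _ hc), ih.2.conj (isConj_map _ hc)⟩

theorem Signed.sw {t : ℕ} {W : F} (h : Signed t W) : Signed t (TwoGen.sw W) := by
  induction h with
  | grown h => exact .grown h.sw
  | fa _ ih => rw [sw_fa]; exact ih.fb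
  | fb _ ih => rw [sw_fb]; exact ih.fa
  | conj _ hc ih => exact ih.conj (isConj_map _ hc)

theorem sw_tv_sw_of_mem {T : F} (hT : T ∈ H) (j : ℤ) :
    sw (tv j (sw T)) = a ^ (-j) * T * a ^ j := by
  induction hT using Subgroup.closure_induction with
  | mem x hx =>
    rcases hx with rfl | rfl
    · rw [sw_a, tv_b, sw_b]
      group
    · simp [mul_assoc]
  | one => simp
  | mul x y _ _ hx hy =>
    rw [_root_.map_mul, _root_.map_mul, _root_.map_mul, hx, hy]
    group
  | inv x _ hx =>
    rw [_root_.map_inv, _root_.map_inv, _root_.map_inv, hx]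
    group

theorem isConj_sw_tv_sw {T : F} (hT : T ∈ H) (j : ℤ) : IsConj (sw (tv j (sw T))) T :=
  isConj_iff.2 ⟨a ^ j, by rw [sw_tv_sw_of_mem hT]; group⟩

theorem num_one_tv_sw_of_mem {T : F} (hT : T ∈ H) (j : ℤ) : num 1 (tv j (sw T)) = num 0 T := by
  rw [← num_conj (isConj_sw_tv_sw hT j), num_sw]
  rfl

/-- The block data of the elements of `H`, with the roles of `a` and `b` exchanged. -/
theorem exists_isBlock_of_mem {T : F} (hT : T ∈ H) (h : 0 < num 1 T) :
    ∃ (n : ℕ) (e : ℕ → Bool) (k : ℕ → ℤ), IsBlock e k n ∧ IsRep (sw T) (blocks e k n) ∧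
      ∀ i < n, slope e i = 0 ∧ k i ≠ 0 := by
  obtain ⟨n, e, k, hb, hr⟩ := exists_isBlock (W := sw T) (by rwa [num_sw])
  refine ⟨n, e, k, hb, hr, fun i hi => ?_⟩
  have hle : ∀ j : ℤ, (k i + j * slope e i).natAbs ≤ num 0 T := fun j => by
    rw [← num_one_tv_sw_of_mem hT j, (isRep_tv hb hr j).num_eq, cnt_one_blocks]
    exact Finset.single_le_sum (f := fun i => (k i + j * slope e i).natAbs)
      (fun _ _ => Nat.zero_le _) (Finset.mem_range.2 hi)
  have h1 := hle 0
  have h2 := hle (2 * num 0 T + 1)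
  have h3 : slope e i = 0 := by
    have h4 : slope e i ≤ -1 ∨ slope e i = 0 ∨ 1 ≤ slope e i := by omega
    rcases h4 with h4 | h4 | h4
    · exfalso
      have : (2 * (num 0 T : ℤ) + 1) * slope e i ≤ -(2 * num 0 T + 1) := by nlinarith
      omega
    · exact h4
    · exfalso
      have : (2 * num 0 T + 1) ≤ (2 * (num 0 T : ℤ) + 1) * slope e i := by nlinarith
      omega
  refine ⟨h3, fun hk => ?_⟩
  have := hb.reduced i hi hk
  rw [slope, ← this] at h3
  cases h : e i <;> simp [h] at h3

theorem num_one_le_of_mem {T : F} (hT : T ∈ H) : num 1 T ≤ num 0 T := by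
  rcases Nat.eq_zero_or_pos (num 1 T) with h | h
  · omega
  obtain ⟨n, e, k, hb, hr, hk⟩ := exists_isBlock_of_mem hT h
  have h0 : num 1 T = n := by
    rw [← cnt_zero_blocks e k n, ← hr.num_eq, num_sw]
    rfl
  have h1 : num 0 T = ∑ i ∈ Finset.range n, (k i).natAbs := by
    rw [← cnt_one_blocks, ← hr.num_eq, num_sw]
    rfl
  rw [h0, h1]
  calc n = ∑ i ∈ Finset.range n, 1 := by simp
    _ ≤ _ := Finset.sum_le_sum fun i hi => by
      have := (hk i (Finset.mem_range.1 hi)).2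
      omega

theorem isSeed_of_mem {T : F} (hT : T ∈ H) (hF : Full T) : IsSeed (num 0 T + num 1 T) T := by
  have h : ∀ i, num i T ≤ num 0 T := fun i => by
    fin_cases i
    · exact le_rfl
    · exact num_one_le_of_mem hT
  refine ⟨hF, fun i => ?_, fun i => ?_, rfl⟩
  · rw [← num_one_tv_sw hF, num_one_tv_sw_of_mem hT]
    exact h i
  · rw [← num_fa 1, ← num_conj (isConj_tv_fa 1 _), ← num_one_tv_sw (hF.map _), sw_fa, tv_fb, num_fb,
      num_one_tv_sw_of_mem hT]
    exact h i

/-- The standard generators of the automorphism group. -/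
inductive IsElem : (F ≃* F) → Prop
  | sw : IsElem sw
  | fa : IsElem fa
  | tv : IsElem (tv 1)
  | conj (g : F) : IsElem (MulAut.conj g)

theorem Signed.map {t : ℕ} {W : F} (h : Signed t W) {α : F ≃* F} (hα : IsElem α) :
    Signed t (α W) ∧ Signed t (α.symm W) := by
  cases hα with
  | sw => exact ⟨h.sw, h.sw⟩
  | fa => exact ⟨h.fa, h.fa⟩
  | tv =>
    refine ⟨h.tv.1, ?_⟩
    convert h.tv.2 using 1
    rw [MulEquiv.symm_apply_eq, tv_tv]
    simp
  | conj g =>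
    refine ⟨h.conj (isConj_iff.2 ⟨g⁻¹, by simp [mul_assoc]⟩),
      h.conj (isConj_iff.2 ⟨g, by simp [mul_assoc]⟩)⟩

/-- The length of the longest common prefix. -/
def lcp : Word → Word → ℕ
  | x :: u, y :: v => if x = y then lcp u v + 1 else 0
  | _, _ => 0

theorem lcp_nil_left (v : Word) : lcp [] v = 0 := by simp [lcp]

theorem lcp_nil_right (u : Word) : lcp u [] = 0 := by cases u <;> simp [lcp]

theorem min_lcp_le (u v w : Word) : min (lcp u v) (lcp v w) ≤ lcp u w := by
  induction u generalizing v w with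
  | nil => simp [lcp_nil_left]
  | cons x u ih =>
    cases v with
    | nil => simp [lcp_nil_left]
    | cons y v =>
      cases w with
      | nil => simp [lcp_nil_right]
      | cons z w =>
        have := ih v w
        by_cases h1 : x = y
        · subst h1
          by_cases h2 : x = z
          · simp only [lcp, h2, if_true]
            omega
          · simp [lcp, h2]
        · simp [lcp, h1]

theorem lcp_take {u v : Word} {h : ℕ} (hh : h ≤ lcp u v) :
    h ≤ u.length ∧ h ≤ v.length ∧ u.take h = v.take h := by
  induction u generalizing v h with
  | nil =>
    obtain rfl : h = 0 := by simpa [lcp_nil_left] using hh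
    simp
  | cons x u ih =>
    cases v with
    | nil =>
      obtain rfl : h = 0 := by simpa [lcp_nil_right] using hh
      simp
    | cons y v =>
      cases h with
      | zero => simp
      | succ h =>
        by_cases h1 : x = y
        · simp only [lcp, h1, if_true, add_le_add_iff_right] at hh
          simpa [h1] using ih hh
        · simp [lcp, h1] at hh

theorem norm_inv_mk_mul_mk {u v : Word} (hu : IsReduced u) (hv : IsReduced v) :
    FreeGroup.norm ((FreeGroup.mk u)⁻¹ * FreeGroup.mk v) + 2 * lcp u v = u.length + v.length := by
  have base : ∀ u v : Word, IsReduced u → IsReduced v →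
      (∀ x ∈ u.head?, ∀ y ∈ v.head?, x ≠ y) →
      FreeGroup.norm ((FreeGroup.mk u)⁻¹ * FreeGroup.mk v) = u.length + v.length := by
    intro u v hu hv h
    have hred : IsReduced (FreeGroup.invRev u ++ v) := by
      refine isReduced_append_iff.2 ⟨by rw [isReduced_iff_reduce_eq, reduce_invRev, hu.reduce_eq],
        hv, ?_⟩
      intro x hx y hy hxy
      cases u with
      | nil => simp [FreeGroup.invRev] at hx
      | cons z u =>
        simp only [FreeGroup.invRev, List.map_cons, List.reverse_cons, List.getLast?_concat,
          Option.mem_def, Option.some.injEq] at hx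
        subst hx
        have := h z (by simp) y hy
        by_contra hne
        apply this
        ext
        · simpa using congrArg Fin.val hxy
        · cases h3 : z.2 <;> cases h4 : y.2 <;> simp_all
    rw [FreeGroup.inv_mk, FreeGroup.mul_mk, FreeGroup.norm, toWord_mk, hred.reduce_eq]
    simp
  induction u generalizing v with
  | nil => simpa [lcp_nil_left] using base [] v hu hv (by simp)
  | cons x u ih =>
    cases v with
    | nil => simpa [lcp_nil_right] using base (x :: u) [] hu hv (by simp)
    | cons y v =>
      by_cases h : x = y
      · subst h
        have := ih (v := v) hu.tail hv.tail
        have e : (FreeGroup.mk (x :: u))⁻¹ * FreeGroup.mk (x :: v) =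
            (FreeGroup.mk u)⁻¹ * FreeGroup.mk v := by
          rw [← List.singleton_append, ← List.singleton_append (l := v), ← FreeGroup.mul_mk,
            ← FreeGroup.mul_mk]
          group
        rw [e]
        simp only [lcp, if_true, List.length_cons]
        omega
      · simpa [lcp, h] using base (x :: u) (y :: v) hu hv (by simpa using h)

/-- The Gromov product on the Cayley tree. -/
def gp (x y : F) : ℕ := lcp x.toWord y.toWord

theorem norm_inv_mul (x y : F) :
    FreeGroup.norm (x⁻¹ * y) + 2 * gp x y = FreeGroup.norm x + FreeGroup.norm y := by
  have := norm_inv_mk_mul_mk (isReduced_toWord (x := x)) (isReduced_toWord (x := y))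
  rwa [mk_toWord, mk_toWord] at this

theorem norm_mul_add (x y : F) :
    FreeGroup.norm (x * y) + 2 * gp x⁻¹ y = FreeGroup.norm x + FreeGroup.norm y := by
  have := norm_inv_mul x⁻¹ y
  rwa [inv_inv, norm_inv_eq] at this

theorem min_gp_le (x y z : F) : min (gp x y) (gp y z) ≤ gp x z := min_lcp_le _ _ _

theorem gp_comm (x y : F) : gp x y = gp y x := by
  have h1 := norm_inv_mul x y
  have h2 := norm_inv_mul y x
  have h3 : FreeGroup.norm (x⁻¹ * y) = FreeGroup.norm (y⁻¹ * x) := by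
    rw [← norm_inv_eq]
    simp
  omega

theorem exists_common_initial {x y : F} {h : ℕ} (hh : h ≤ gp x y) :
    ∃ p, FreeGroup.norm p = h ∧ FreeGroup.norm (p⁻¹ * x) + h = FreeGroup.norm x ∧
      FreeGroup.norm (p⁻¹ * y) + h = FreeGroup.norm y := by
  obtain ⟨h1, h2, h3⟩ := lcp_take hh
  have key : ∀ z : F, h ≤ z.toWord.length → FreeGroup.norm (FreeGroup.mk (z.toWord.take h)) = h ∧
      FreeGroup.norm ((FreeGroup.mk (z.toWord.take h))⁻¹ * z) + h = FreeGroup.norm z := by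
    intro z hz
    have hr := isReduced_toWord (x := z)
    rw [← List.take_append_drop h z.toWord] at hr
    obtain ⟨r1, r2, -⟩ := isReduced_append_iff.1 hr
    constructor
    · rw [FreeGroup.norm, toWord_mk, r1.reduce_eq]
      simpa using hz
    · have e : (FreeGroup.mk (z.toWord.take h))⁻¹ * z = FreeGroup.mk (z.toWord.drop h) := by
        rw [inv_mul_eq_iff_eq_mul, FreeGroup.mul_mk, List.take_append_drop, mk_toWord]
      rw [e, FreeGroup.norm, toWord_mk, r2.reduce_eq, FreeGroup.norm, List.length_drop]
      omega
  refine ⟨FreeGroup.mk (x.toWord.take h), (key x h1).1, (key x h1).2, ?_⟩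
  rw [h3]
  exact (key y h2).2

theorem two_mul_gp_inv_lt {y : F} (hy : y ≠ 1) : 2 * gp y⁻¹ y < FreeGroup.norm y := by
  have h1 := norm_mul_add y y
  have h2 := reduceCyclically.reduce_flatten_replicate_succ (isReduced_toWord (x := y)) 1
  have h3 : FreeGroup.norm (y * y) = (reduce (List.replicate (1 + 1) y.toWord).flatten).length := by
    rw [FreeGroup.norm, toWord_mul]
    simp [List.replicate]
  have h4 := congrArg List.length (reduceCyclically.conj_conjugator_reduceCyclically y.toWord)
  have h5 : 0 < (reduceCyclically y.toWord).length :=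
    List.length_pos_iff.2 ((isRep_reduceCyclically y).ne_nil hy)
  rw [h2] at h3
  simp only [List.length_append, List.replicate, List.flatten_cons, List.flatten_nil,
    FreeGroup.invRev_length, List.append_nil] at h3 h4
  rw [FreeGroup.norm] at h1
  unfold FreeGroup.norm at *
  omega

/-- The subgroup generated by the standard generators. -/
def elemAut : Subgroup (MulAut F) := Subgroup.closure {α | IsElem α}

theorem mem_elemAut {α : MulAut F} (h : IsElem α) : α ∈ elemAut := Subgroup.subset_closure h

/-- A counterexample to generation, of minimal total length. -/
structure IsMin (α : MulAut F) : Prop where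
  not_mem : α ∉ elemAut
  le : ∀ β : MulAut F, β ∉ elemAut →
    FreeGroup.norm (α a) + FreeGroup.norm (α b) ≤ FreeGroup.norm (β a) + FreeGroup.norm (β b)

theorem IsMin.of_eq {α β : MulAut F} (h : IsMin α) (hβ : β ∈ elemAut)
    (hN : FreeGroup.norm ((α * β) a) + FreeGroup.norm ((α * β) b) ≤
      FreeGroup.norm (α a) + FreeGroup.norm (α b)) : IsMin (α * β) where
  not_mem hm := h.not_mem ((Subgroup.mul_mem_cancel_right _ hβ).1 hm)
  le γ hγ := hN.trans (h.le γ hγ)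

theorem IsMin.sw {α : MulAut F} (h : IsMin α) : IsMin (α * sw) :=
  h.of_eq (mem_elemAut .sw) (by simp [add_comm])

theorem IsMin.fa {α : MulAut F} (h : IsMin α) : IsMin (α * fa) :=
  h.of_eq (mem_elemAut .fa) (by simp [norm_inv_eq])

theorem IsMin.fb {α : MulAut F} (h : IsMin α) : IsMin (α * fb) := by
  have e : α * TwoGen.fb = α * TwoGen.sw * TwoGen.fa * TwoGen.sw :=
    aut_ext (by simp) (by simp)
  rw [e]
  exact h.sw.fa.sw

/-- The image of a letter. -/
def im (α : MulAut F) (x : Fin 2 × Bool) : F := α (FreeGroup.mk [x])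

/-- The inverse letter. -/
def bar (x : Fin 2 × Bool) : Fin 2 × Bool := (x.1, !x.2)

theorem im_bar (α : MulAut F) (x : Fin 2 × Bool) : im α (bar x) = (im α x)⁻¹ := by
  rw [im, im, ← _root_.map_inv, FreeGroup.inv_mk]
  rfl

theorem im_ne_one (α : MulAut F) (x : Fin 2 × Bool) : im α x ≠ 1 := by
  rw [im, Ne, MulEquiv.map_eq_one_iff, ← toWord_eq_nil_iff, toWord_mk]
  simp

/-- The letters can be brought into standard position. -/
theorem IsMin.exists_std {α : MulAut F} (h : IsMin α) {x y : Fin 2 × Bool} (hxy : x.1 ≠ y.1) :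
    ∃ β : MulAut F, IsMin β ∧ β a = im α x ∧ β b = im α y := by
  have key : ∀ s t : Bool, ∀ α : MulAut F, IsMin α →
      ∃ β : MulAut F, IsMin β ∧ β a = im α (0, s) ∧ β b = im α (1, t) := by
    intro s t α h
    simp only [im, mk_letter_a, mk_letter_b]
    cases s <;> cases t
    · exact ⟨_, h.fa.fb, by simp, by simp⟩
    · exact ⟨_, h.fa, by simp, by simp⟩
    · exact ⟨_, h.fb, by simp, by simp⟩
    · exact ⟨_, h, by simp, by simp⟩
  obtain ⟨i, s⟩ := x
  obtain ⟨j, t⟩ := y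
  fin_cases i <;> fin_cases j
  · exact absurd rfl hxy
  · exact key s t α h
  · obtain ⟨β, h1, h2, h3⟩ := key s t _ h.sw
    refine ⟨β, h1, h2.trans ?_, h3.trans ?_⟩
    · cases s <;> simp [im, mk_letter_a, mk_letter_b]
    · cases t <;> simp [im, mk_letter_a, mk_letter_b]
  · exact absurd rfl hxy

theorem IsMin.norm_le {α : MulAut F} (h : IsMin α) : 2 * gp (α a)⁻¹ (α b) ≤ FreeGroup.norm (α b) := by
  have h1 := norm_mul_add (α a) (α b)
  have h2 : α * tv 1 ∉ elemAut := fun hm =>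
    h.not_mem ((Subgroup.mul_mem_cancel_right _ (mem_elemAut .tv)).1 hm)
  have h3 := h.le _ h2
  simp only [MulAut.mul_apply, tv_a, tv_b, zpow_one, _root_.map_mul] at h3
  omega

theorem IsMin.gp_le {α : MulAut F} (h : IsMin α) {x y : Fin 2 × Bool} (hxy : x.1 ≠ y.1) :
    2 * gp (im α x)⁻¹ (im α y) ≤ FreeGroup.norm (im α y) := by
  obtain ⟨β, h1, h2, h3⟩ := h.exists_std hxy
  rw [← h2, ← h3]
  exact h1.norm_le

theorem IsMin.not_tie {α : MulAut F} (h : IsMin α)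
    (h1 : 2 * gp (α a)⁻¹ (α b) = FreeGroup.norm (α b))
    (h2 : 2 * gp (α b)⁻¹ (α a) = FreeGroup.norm (α b)) : False := by
  have hv : 0 < FreeGroup.norm (α b) := by
    rw [pos_iff_ne_zero, Ne, FreeGroup.norm_eq_zero, MulEquiv.map_eq_one_iff]
    decide
  have hle := h.sw.norm_le
  simp only [MulAut.mul_apply, sw_a, sw_b] at hle
  obtain ⟨γ, hγ⟩ : ∃ γ : F → MulAut F, ∀ q, γ q ∉ elemAut ∧ (γ q) a = q⁻¹ * (α a * α b) * q ∧
      (γ q) b = q⁻¹ * α b * q := by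
    refine ⟨fun q => MulAut.conj q⁻¹ * α * tv 1, fun q => ⟨fun hm => h.not_mem ?_, ?_, ?_⟩⟩
    · exact (Subgroup.mul_mem_cancel_left _ (mem_elemAut (.conj q⁻¹))).1
        ((Subgroup.mul_mem_cancel_right _ (mem_elemAut .tv)).1 hm)
    · simp
    · simp
  have hmin := fun q => h.le _ (hγ q).1
  generalize α a = u at *
  generalize α b = v at *
  obtain ⟨p, hp, hpu, hpv⟩ := exists_common_initial le_rfl (x := u⁻¹) (y := v) (h := gp u⁻¹ v)
  obtain ⟨q, hq, hqv, hqu⟩ := exists_common_initial le_rfl (x := v⁻¹) (y := u) (h := gp v⁻¹ u)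
  -- `p` and `v * q` are both the midpoint of `v`
  have hpq : v * q = p := by
    have e1 := norm_inv_mul p v
    have e2 := norm_inv_mul v (v * q)
    have e3 := norm_inv_mul p (v * q)
    have e4 := min_gp_le p v (v * q)
    have e5 : FreeGroup.norm (v * q) = FreeGroup.norm (q⁻¹ * v⁻¹) := by
      rw [← norm_inv_eq]
      simp
    rw [norm_inv_eq] at hqv
    rw [show v⁻¹ * (v * q) = q by group] at e2
    have e6 : FreeGroup.norm (p⁻¹ * (v * q)) = 0 := by omega
    rw [FreeGroup.norm_eq_zero, inv_mul_eq_one] at e6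
    exact e6.symm
  have hX : FreeGroup.norm (u⁻¹ * q) = FreeGroup.norm (q⁻¹ * u) := by
    rw [← norm_inv_eq]
    simp
  have e1 := norm_inv_mul u⁻¹ (u⁻¹ * q)
  have e2 := norm_inv_mul p u⁻¹
  have e3 := norm_inv_mul p (u⁻¹ * q)
  have e4 := min_gp_le p u⁻¹ (u⁻¹ * q)
  rw [show u⁻¹⁻¹ * (u⁻¹ * q) = q by group] at e1
  rw [norm_inv_eq] at e1 e2 hpu
  obtain ⟨-, g2, g3⟩ := hγ q
  have h3 := hmin q
  rw [g2, g3, mul_assoc, mul_assoc, mul_assoc, hpq] at h3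
  have e5 := norm_mul_le q⁻¹ p
  rw [norm_inv_eq] at e5
  have e6 : FreeGroup.norm (p⁻¹ * (u⁻¹ * q)) = FreeGroup.norm (q⁻¹ * (u * p)) := by
    rw [← norm_inv_eq]
    simp [mul_assoc]
  omega

/-- The second Nielsen condition. -/
theorem IsMin.gp_add_lt {α : MulAut F} (h : IsMin α) {x y z : Fin 2 × Bool} (hxy : Compat x y)
    (hyz : Compat y z) :
    gp (im α x)⁻¹ (im α y) + gp (im α y)⁻¹ (im α z) < FreeGroup.norm (im α y) := by
  have hy := two_mul_gp_inv_lt (im_ne_one α y)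
  have heq : ∀ {x y : Fin 2 × Bool}, Compat x y → x.1 = y.1 → x = y := fun {x y} hc h1 =>
    Prod.ext h1 (hc h1)
  have hbar : ∀ {x : Fin 2 × Bool}, x.1 ≠ y.1 →
      2 * gp (im α y)⁻¹ (im α x) ≤ FreeGroup.norm (im α y) := fun {x} hx => by
    have := h.gp_le (x := bar x) (y := bar y) hx
    rwa [im_bar, im_bar, inv_inv, norm_inv_eq, gp_comm] at this
  by_cases h1 : x.1 = y.1
  · obtain rfl := heq hxy h1
    by_cases h2 : x.1 = z.1
    · obtain rfl := heq hyz h2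
      omega
    · have := hbar (Ne.symm h2)
      omega
  · have e1 := h.gp_le h1
    by_cases h2 : y.1 = z.1
    · obtain rfl := heq hyz h2
      omega
    · have e2 := hbar (Ne.symm h2)
      by_contra hlt
      have h3 : x.1 = z.1 := by
        obtain ⟨⟨i, -⟩, ⟨j, -⟩, ⟨k, -⟩⟩ := (⟨x, y, z⟩ : (Fin 2 × Bool) × (Fin 2 × Bool) × (Fin 2 × Bool))
        omega
      by_cases h4 : x.2 = z.2
      · obtain rfl : x = z := Prod.ext h3 h4
        obtain ⟨β, hβ, hβa, hβb⟩ := h.exists_std h1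
        refine hβ.not_tie ?_ ?_
        · rw [hβa, hβb]
          omega
        · rw [hβa, hβb]
          omega
      · obtain rfl : z = bar x := by
          refine Prod.ext h3.symm ?_
          change z.2 = !x.2
          cases h5 : x.2 <;> cases h6 : z.2 <;> simp_all
        rw [im_bar] at hlt e2
        have e3 := min_gp_le (im α y)⁻¹ (im α x)⁻¹ (im α y)
        omega

theorem IsMin.norm_map {α : MulAut F} (h : IsMin α) (w : Word) (x : Fin 2 × Bool) :
    IsReduced (x :: w) →
      (∀ z, Compat z x → gp (im α z)⁻¹ (α (FreeGroup.mk (x :: w))) = gp (im α z)⁻¹ (im α x)) ∧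
      ∀ y ∈ x :: w, FreeGroup.norm (im α y) ≤ FreeGroup.norm (α (FreeGroup.mk (x :: w))) := by
  induction w generalizing x with
  | nil => exact fun _ => ⟨fun z _ => rfl, by simp [im]⟩
  | cons y w ih =>
    intro hw
    obtain ⟨hxy, hw'⟩ := List.isChain_cons_cons.1 hw
    obtain ⟨ih1, ih2⟩ := ih y hw'
    have e : α (FreeGroup.mk (x :: y :: w)) = im α x * α (FreeGroup.mk (y :: w)) := by
      rw [im, ← _root_.map_mul, FreeGroup.mul_mk]
      rfl
    rw [e]
    have n1 := norm_mul_add (im α x) (α (FreeGroup.mk (y :: w)))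
    rw [ih1 x hxy] at n1
    have n2 : 2 * gp (im α x)⁻¹ (im α y) ≤ FreeGroup.norm (im α x) ∧
        2 * gp (im α x)⁻¹ (im α y) ≤ FreeGroup.norm (im α y) := by
      by_cases h1 : x.1 = y.1
      · obtain rfl : x = y := Prod.ext h1 (hxy h1)
        have := two_mul_gp_inv_lt (im_ne_one α x)
        omega
      · have := h.gp_le (x := bar y) (y := bar x) (Ne.symm h1)
        rw [im_bar, im_bar, inv_inv, norm_inv_eq, gp_comm] at this
        exact ⟨this, h.gp_le h1⟩
    have n3 := ih2 y (by simp)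
    constructor
    · intro z hz
      have n4 := h.gp_add_lt hz hxy
      have n5 := norm_inv_mul (im α x) (im α x * α (FreeGroup.mk (y :: w)))
      rw [inv_mul_cancel_left] at n5
      have n6 := min_gp_le (im α z)⁻¹ (im α x) (im α x * α (FreeGroup.mk (y :: w)))
      have n7 := min_gp_le (im α z)⁻¹ (im α x * α (FreeGroup.mk (y :: w))) (im α x)
      rw [gp_comm _ (im α x)] at n7
      omega
    · intro z hz
      rcases List.mem_cons.1 hz with rfl | hz
      · omega
      · have := ih2 z hz
        omega

theorem IsMin.norm_le_one {α : MulAut F} (h : IsMin α) {V : F} (hV : FreeGroup.norm (α V) = 1)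
    {y : Fin 2 × Bool} (hy : y ∈ V.toWord) : FreeGroup.norm (im α y) ≤ 1 := by
  have hr := isReduced_toWord (x := V)
  rw [← hV, ← mk_toWord (x := V)]
  cases e : V.toWord with
  | nil => simp [e] at hy
  | cons x w =>
    rw [e] at hy hr
    exact (h.norm_map w x hr).2 y hy

theorem exists_letter_of_norm {V : F} (h : FreeGroup.norm V = 1) : ∃ l, V = FreeGroup.mk [l] := by
  obtain ⟨l, hl⟩ := List.length_eq_one_iff.1 h
  exact ⟨l, by rw [← hl, mk_toWord]⟩

theorem not_isMin (α : MulAut F) : ¬ IsMin α := by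
  intro h
  have na : FreeGroup.norm a = 1 := norm_of 0
  have nb : FreeGroup.norm b = 1 := norm_of 1
  have key : ∀ i : Fin 2, FreeGroup.norm (im α (i, true)) = 1 := by
    intro i
    have h1 : FreeGroup.norm (im α (i, true)) ≠ 0 := by
      rw [Ne, FreeGroup.norm_eq_zero]
      exact im_ne_one α _
    suffices ∃ s, FreeGroup.norm (im α (i, s)) ≤ 1 by
      obtain ⟨s, hs⟩ := this
      cases s
      · rw [show ((i, false) : Fin 2 × Bool) = bar (i, true) from rfl, im_bar, norm_inv_eq] at hs
        omega
      · omega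
    by_contra hcon
    have hno : ∀ V : F, FreeGroup.norm (α V) = 1 → ∀ y ∈ V.toWord, y.1 ≠ i := by
      rintro V hV ⟨j, s⟩ hy rfl
      exact hcon ⟨s, h.norm_le_one hV hy⟩
    have hpow : ∀ V : F, FreeGroup.norm (α V) = 1 →
        V ∈ Subgroup.zpowers (FreeGroup.of (1 - i) : F) := by
      intro V hV
      have : ∀ w : Word, (∀ y ∈ w, y.1 ≠ i) →
          FreeGroup.mk w ∈ Subgroup.zpowers (FreeGroup.of (1 - i) : F) := by
        intro w hw
        induction w with
        | nil => exact one_mem _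
        | cons y w ih =>
          rw [← List.singleton_append, ← FreeGroup.mul_mk]
          refine mul_mem ?_ (ih fun z hz => hw z (by simp [hz]))
          obtain ⟨j, s⟩ := y
          have hj : j = 1 - i := by
            have := hw (j, s) (by simp)
            simp only at this
            omega
          subst hj
          cases s
          · rw [show (FreeGroup.mk [(1 - i, false)] : F) = (FreeGroup.of (1 - i))⁻¹ from rfl]
            exact inv_mem (Subgroup.mem_zpowers _)
          · exact Subgroup.mem_zpowers _
      rw [← mk_toWord (x := V)]
      exact this _ (hno V hV)
    obtain ⟨m, hm⟩ := hpow (α.symm a) (by simpa using na)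
    obtain ⟨n, hn⟩ := hpow (α.symm b) (by simpa using nb)
    have hcomm : α.symm a * α.symm b = α.symm b * α.symm a := by
      simp only [← hm, ← hn, ← zpow_add, add_comm]
    rw [← _root_.map_mul, ← _root_.map_mul, EmbeddingLike.apply_eq_iff_eq] at hcomm
    exact absurd hcomm (by decide)
  obtain ⟨⟨i, s⟩, hl⟩ := exists_letter_of_norm (key 0)
  obtain ⟨⟨j, t⟩, hl'⟩ := exists_letter_of_norm (key 1)
  rw [im, mk_letter_a, cond_true, zpow_one] at hl
  rw [im, mk_letter_b, cond_true, zpow_one] at hl'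
  have msw := mem_elemAut .sw
  have mfa := mem_elemAut .fa
  have mfb : fb ∈ elemAut := by
    have e : fb = (sw * fa * sw : MulAut F) := aut_ext (by simp) (by simp)
    rw [e]
    exact mul_mem (mul_mem msw mfa) msw
  have hij : i ≠ j := by
    rintro rfl
    by_cases hst : s = t
    · subst hst
      rw [← hl', EmbeddingLike.apply_eq_iff_eq] at hl
      exact absurd hl (by decide)
    · have : (FreeGroup.mk [(i, s)] : F) = (FreeGroup.mk [(i, t)])⁻¹ := by
        rw [FreeGroup.inv_mk]
        cases s <;> cases t <;> simp_all [FreeGroup.invRev]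
      rw [this, ← hl', ← _root_.map_inv, EmbeddingLike.apply_eq_iff_eq] at hl
      exact absurd hl (by decide)
  have hsig : ∃ β ∈ elemAut, β a = FreeGroup.mk [(i, s)] ∧ β b = FreeGroup.mk [(j, t)] := by
    fin_cases i <;> fin_cases j
    · exact absurd rfl hij
    · simp only [Fin.zero_eta, Fin.mk_one, mk_letter_a, mk_letter_b]
      cases s <;> cases t
      · exact ⟨_, mul_mem mfa mfb, by simp, by simp⟩
      · exact ⟨_, mfa, by simp, by simp⟩
      · exact ⟨_, mfb, by simp, by simp⟩
      · exact ⟨_, one_mem _, by simp, by simp⟩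
    · simp only [Fin.zero_eta, Fin.mk_one, mk_letter_a, mk_letter_b]
      cases s <;> cases t
      · exact ⟨_, mul_mem msw (mul_mem mfa mfb), by simp, by simp⟩
      · exact ⟨_, mul_mem msw mfa, by simp, by simp⟩
      · exact ⟨_, mul_mem msw mfb, by simp, by simp⟩
      · exact ⟨_, msw, by simp, by simp⟩
    · exact absurd rfl hij
  obtain ⟨β, hβ, h1, h2⟩ := hsig
  have : α = β := aut_ext (hl.trans h1.symm) (hl'.trans h2.symm)
  exact h.not_mem (this ▸ hβ)

/-- The automorphism group of the free group of rank two is generated by `IsElem`. -/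
theorem elemAut_eq_top : elemAut = ⊤ := by
  by_contra hne
  obtain ⟨α, hα⟩ : ∃ α, α ∉ elemAut := by
    by_contra! hall
    exact hne (eq_top_iff.2 fun α _ => hall α)
  obtain ⟨β, hβ, hmin⟩ := WellFounded.has_min
    (measure fun α : MulAut F => FreeGroup.norm (α a) + FreeGroup.norm (α b)).wf
    {α | α ∉ elemAut} ⟨α, hα⟩
  exact not_isMin β ⟨hβ, fun γ hγ => not_lt.1 (hmin γ hγ)⟩

/-- A predicate preserved by the standard generators and their inverses is preserved by all
automorphisms. -/
theorem aut_induction {P : F → Prop}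
    (h : ∀ W, P W → ∀ α : F ≃* F, IsElem α → P (α W) ∧ P (α.symm W)) (α : F ≃* F) {W : F}
    (hW : P W) : P (α W) := by
  have hα : (α : MulAut F) ∈ elemAut := by
    rw [elemAut_eq_top]
    trivial
  induction hα using Subgroup.closure_induction_left with
  | one => exact hW
  | mul_left x hx y _ ih => exact (h _ ih x hx).1
  | inv_mul_cancel x hx y _ ih => exact (h _ ih x hx).2

/-- Nontrivial elements of `H` in the commutator subgroup have minimal length in their orbit. -/
theorem num_le_of_mem {T : F} (hT : T ∈ H) (hF : Full T) (α : F ≃* F) :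
    num 0 T + num 1 T ≤ num 0 (α T) + num 1 (α T) :=
  (aut_induction (P := Signed (num 0 T + num 1 T)) (fun _ hW _ hα => hW.map hα) α
    (.grown (.seed (isSeed_of_mem hT hF)))).le

/-- The value of a letter under the linear functional `(f, g)` on the plane. -/
def lv (f g : ℝ) (l : Fin 2 × Bool) : ℝ := cond l.2 1 (-1) * (if l.1 = 0 then f else g)

/-- The value of the endpoint of a word under the linear functional `(f, g)`. -/
def ph (f g : ℝ) (w : Word) : ℝ := (w.map (lv f g)).sum

/-- The maximum of the linear functional `(f, g)` along the path traced by a word. -/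
def mx (f g : ℝ) : Word → ℝ
  | [] => 0
  | l :: w => max 0 (lv f g l + mx f g w)

theorem ph_cons (f g : ℝ) (l : Fin 2 × Bool) (w : Word) : ph f g (l :: w) = lv f g l + ph f g w := by
  simp [ph]

theorem ph_append (f g : ℝ) (u v : Word) : ph f g (u ++ v) = ph f g u + ph f g v := by
  simp [ph]

theorem ph_eq (f g : ℝ) (w : Word) : ph f g w = f * aSum w + g * bSum w := by
  induction w with
  | nil => simp [ph, aSum, bSum]
  | cons l w ih =>
    rw [ph_cons, ih]
    obtain ⟨i, s⟩ := l
    fin_cases i <;> cases s <;> simp [lv, aSum, bSum] <;> ring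

theorem mx_nonneg (f g : ℝ) (w : Word) : 0 ≤ mx f g w := by
  cases w
  · exact le_rfl
  · exact le_max_left _ _

theorem ph_le_mx (f g : ℝ) (w : Word) : ph f g w ≤ mx f g w := by
  induction w with
  | nil => simp [ph, mx]
  | cons l w ih =>
    rw [mx, ph_cons]
    exact le_max_of_le_right (add_le_add_right ih _)

theorem mx_append (f g : ℝ) (u v : Word) :
    mx f g (u ++ v) = max (mx f g u) (ph f g u + mx f g v) := by
  induction u with
  | nil => simp [mx, ph, mx_nonneg]
  | cons l u ih =>
    rw [List.cons_append, mx, ih, mx, ph_cons, max_assoc, ← max_add_add_left, add_assoc]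

theorem mx_append_comm {f g : ℝ} {u v : Word} (h : ph f g (u ++ v) = 0) :
    mx f g (v ++ u) = mx f g (u ++ v) - ph f g u := by
  rw [ph_append] at h
  rw [mx_append, mx_append, ← max_sub_sub_right, max_comm]
  congr 1 <;> linarith

/-- The endpoint of a word as a homomorphism on the free group. -/
def phHom (f g : ℝ) : F →* Multiplicative ℝ :=
  FreeGroup.lift ![Multiplicative.ofAdd f, Multiplicative.ofAdd g]

theorem phHom_mk (f g : ℝ) (w : Word) : phHom f g (FreeGroup.mk w) = Multiplicative.ofAdd (ph f g w) := by
  induction w with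
  | nil => simp [ph, ← FreeGroup.one_eq_mk]
  | cons l w ih =>
    rw [← List.singleton_append, ph_append, ofAdd_add, ← ih, ← FreeGroup.mul_mk, _root_.map_mul]
    congr 1
    obtain ⟨i, s⟩ := l
    fin_cases i <;> cases s <;> simp [phHom, ph, lv]

theorem ph_eq_zero {W : F} (hW : W ∈ commutator F) {w : Word} (h : IsRep W w) (f g : ℝ) :
    ph f g w = 0 := by
  have h1 : phHom f g W = 1 := (Abelianization.commutator_subset_ker (phHom f g) : commutator F ≤ _) hW
  have h2 := isConj_iff_eq.1 ((phHom f g).map_isConj h.2)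
  rw [h1, phHom_mk] at h2
  exact ofAdd_eq_one.1 h2.symm

/-- The convex hull of the path traced by `w` is the sum of a segment with direction vector `d`
and the unit square, in terms of support functions. -/
def LineRep (d : ℝ × ℝ) (w : Word) : Prop :=
  ∃ x : ℝ × ℝ, ∀ f g : ℝ, mx f g w =
    max (f * x.1 + g * x.2) (f * (x.1 + d.1) + g * (x.2 + d.2)) + max f 0 + max g 0

theorem LineRep.of_isRep {W : F} (hW : W ∈ commutator F) {w w' : Word} (h : IsRep W w)
    (h' : IsRep W w') {d : ℝ × ℝ} (hd : LineRep d w) : LineRep d w' := by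
  obtain ⟨n, rfl⟩ := h.isRotated h'
  rw [← List.rotate_mod]
  rcases w with - | ⟨l, w⟩
  · simpa using hd
  have hlt := Nat.mod_lt n (List.length_pos_of_ne_nil (List.cons_ne_nil l w))
  generalize hw0 : l :: w = w0 at *
  rw [List.rotate_eq_drop_append_take hlt.le]
  set u := w0.take (n % w0.length)
  set v := w0.drop (n % w0.length)
  have huv : u ++ v = w0 := List.take_append_drop _ _
  obtain ⟨x, hx⟩ := hd
  refine ⟨(x.1 - aSum u, x.2 - bSum u), fun f g => ?_⟩
  rw [mx_append_comm (by rw [huv]; exact ph_eq_zero hW h f g), huv, hx, ph_eq,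
    add_sub_right_comm, add_sub_right_comm, ← max_sub_sub_right]
  congr 3 <;> ring

/-- Some cyclically reduced word representing the class of `W` satisfies `LineRep d`. -/
def LineG (d : ℝ × ℝ) (W : F) : Prop := ∃ w, IsRep W w ∧ LineRep d w

theorem LineG.conj {d : ℝ × ℝ} {W V : F} (h : LineG d W) (hV : IsConj V W) : LineG d V := by
  obtain ⟨w, hw, hd⟩ := h
  exact ⟨w, hw.conj hV, hd⟩

theorem mx_map {f g f' g' : ℝ} {m : Fin 2 × Bool → Fin 2 × Bool}
    (h : ∀ l, lv f g (m l) = lv f' g' l) (w : Word) : mx f g (w.map m) = mx f' g' w := by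
  induction w with
  | nil => rfl
  | cons l w ih => rw [List.map_cons, mx, mx, ih, h]

theorem LineG.sw {d : ℝ × ℝ} {W : F} (h : LineG d W) : LineG d.swap (sw W) := by
  obtain ⟨w, hw, x, hx⟩ := h
  refine ⟨_, isLetterMap_sw.isRep hw, x.swap, fun f g => ?_⟩
  rw [mx_map (f' := g) (g' := f), hx]
  · simp only [Prod.fst_swap, Prod.snd_swap]
    rw [add_assoc, add_comm (max g 0), ← add_assoc]
    congr 3 <;> ring
  · rintro ⟨i, s⟩
    fin_cases i <;> simp [lv]

theorem max_neg_zero (f : ℝ) : max (-f) 0 = max f 0 - f := by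
  rcases le_total 0 f with h | h
  · rw [max_eq_left h, max_eq_right (by linarith)]
    ring
  · rw [max_eq_right h, max_eq_left (by linarith)]
    ring

theorem LineG.fa {d : ℝ × ℝ} {W : F} (h : LineG d W) : LineG (-d.1, d.2) (fa W) := by
  obtain ⟨w, hw, x, hx⟩ := h
  refine ⟨_, isLetterMap_fa.isRep hw, (-x.1 - 1, x.2), fun f g => ?_⟩
  rw [mx_map (f' := -f) (g' := g), hx, max_neg_zero]
  · rw [← add_sub_assoc, add_sub_right_comm, ← max_sub_sub_right]
    congr 3 <;> ring
  · rintro ⟨i, s⟩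
    fin_cases i <;> cases s <;> simp [lv]

/-- The value at the beginning of the `i`-th block. -/
def pt (e : ℕ → Bool) (k : ℕ → ℤ) (f g : ℝ) : ℕ → ℝ
  | 0 => 0
  | n + 1 => pt e k f g n + cond (e n) 1 (-1) * f + k n * g

/-- The value at the left end of the `a`-edge of the `i`-th block. -/
def lt (e : ℕ → Bool) (k : ℕ → ℤ) (f g : ℝ) (i : ℕ) : ℝ := pt e k f g i - cond (e i) 0 1 * f

theorem mx_bpow (f g : ℝ) (k : ℤ) : mx f g (bpow k) = max 0 (k * g) := by
  have key : ∀ (n : ℕ) (s : Bool), mx f g (List.replicate n ((1 : Fin 2), s)) =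
      max 0 (n * (cond s 1 (-1) * g)) := by
    intro n s
    induction n with
    | zero => simp [mx]
    | succ n ih =>
      rw [List.replicate_succ, mx, ih]
      simp only [lv, one_ne_zero, if_false]
      set c := cond s 1 (-1) * g
      push_cast
      rcases le_total 0 c with h | h
      · have : 0 ≤ n * c := by positivity
        rw [max_eq_right this, add_mul, add_comm, one_mul]
      · have : n * c ≤ 0 := mul_nonpos_of_nonneg_of_nonpos (by positivity) h
        rw [max_eq_left this, add_mul, max_eq_left (by linarith), max_eq_left (by linarith)]
  rw [bpow, key]
  rcases le_or_gt 0 k with h | h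
  · simp [h, abs_of_nonneg h]
  · simp [not_le.2 h, abs_of_neg h]

theorem ph_bpow (f g : ℝ) (k : ℤ) : ph f g (bpow k) = k * g := by
  have := phHom_mk f g (bpow k)
  rw [mk_bpow, map_zpow, show phHom f g b = Multiplicative.ofAdd g by simp [phHom, b],
    ← ofAdd_zsmul] at this
  simpa using (Multiplicative.ofAdd.injective this).symm

theorem ph_blocks (e : ℕ → Bool) (k : ℕ → ℤ) (f g : ℝ) (n : ℕ) :
    ph f g (blocks e k n) = pt e k f g n := by
  induction n with
  | zero => rfl
  | succ n ih =>
    rw [blocks, ph_append, ih, ← List.singleton_append, ph_append, ph_bpow, pt, ← add_assoc]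
    simp [ph, lv]

theorem mx_blocks_le (e : ℕ → Bool) (k : ℕ → ℤ) (f g C : ℝ) (n : ℕ) :
    mx f g (blocks e k n) ≤ C ↔
      0 ≤ C ∧ pt e k f g n ≤ C ∧ ∀ i < n, lt e k f g i + max f 0 ≤ C := by
  have key : ∀ i, lt e k f g i + max f 0 = max (pt e k f g i) (pt e k f g i + cond (e i) 1 (-1) * f) := by
    intro i
    rw [lt]
    cases e i
    · simp only [cond_false]
      rw [← max_add_add_left]
      congr 1 <;> ring
    · simp only [cond_true]
      rw [← max_add_add_left, max_comm]
      congr 1 <;> ring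
  induction n with
  | zero => simp [blocks, mx, pt]
  | succ n ih =>
    have ih' : _ ↔ _ := ih
    rw [blocks, mx_append, max_le_iff, ih', mx, mx_bpow, ph_blocks, ← max_add_add_left,
      ← max_add_add_left, ← max_add_add_left, max_le_iff, max_le_iff]
    simp only [Nat.lt_succ_iff_lt_or_eq, or_imp, forall_and, forall_eq, key n, max_le_iff]
    simp only [lv, if_true, add_zero, pt, add_assoc]
    tauto

theorem IsBlock.mx_le {e : ℕ → Bool} {k : ℕ → ℤ} {n : ℕ} (hb : IsBlock e k n) {f g : ℝ}
    (h : ph f g (blocks e k n) = 0) (C : ℝ) :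
    mx f g (blocks e k n) ≤ C ↔ ∀ i < n, lt e k f g i + max f 0 ≤ C := by
  rw [ph_blocks] at h
  rw [mx_blocks_le, h]
  refine ⟨fun h => h.2.2, fun h => ?_⟩
  have h0 : 0 ≤ C := by
    refine le_trans ?_ (h 0 hb.pos)
    rw [lt, pt]
    have := le_max_left f 0
    have := le_max_right f 0
    cases e 0 <;> simp
  exact ⟨h0, h0, h⟩

theorem lt_tv (j : ℤ) (e : ℕ → Bool) (k : ℕ → ℤ) (f g : ℝ) (i : ℕ) :
    lt e (fun i => k i + j * slope e i) f g i = lt e k (f + j * g) g i + j * cond (e 0) 0 1 * g := by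
  have : pt e (fun i => k i + j * slope e i) f g i = pt e k (f + j * g) g i +
      j * cond (e 0) 0 1 * g - j * cond (e i) 0 1 * g := by
    induction i with
    | zero => simp [pt]
    | succ i ih =>
      rw [pt, pt, ih]
      simp only [slope]
      push_cast
      cases e i <;> cases e (i + 1) <;> simp <;> ring
  rw [lt, lt, this]
  ring

theorem LineG.tv {d : ℝ × ℝ} {W : F} (h : LineG d W) (hW : W ∈ commutator F) (h0 : 0 < num 0 W)
    (j : ℤ) : LineG (d.1, d.2 + j * d.1) (tv j W) := by
  obtain ⟨w, hw, hd⟩ := h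
  obtain ⟨n, e, k, hb, hr⟩ := exists_isBlock h0
  obtain ⟨x, hx⟩ := hd.of_isRep hW hw hr
  have hr' := isRep_tv hb hr j
  refine ⟨_, hr', (x.1, x.2 + j * x.1 + j * cond (e 0) 0 1), fun f g => ?_⟩
  have h1 := hb.mx_le (ph_eq_zero hW hr (f + j * g) g)
  have h2 := (hb.tv j).mx_le (ph_eq_zero (map_mem_commutator (TwoGen.tv j) hW) hr' f g)
  simp only [lt_tv] at h2
  have key : mx f g (blocks e (fun i => k i + j * slope e i) n) =
      mx (f + j * g) g (blocks e k n) - max (f + j * g) 0 + max f 0 + j * cond (e 0) 0 1 * g := by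
    refine eq_of_forall_ge_iff fun C => ?_
    rw [h2]
    have := h1 (C + max (f + j * g) 0 - max f 0 - j * cond (e 0) 0 1 * g)
    constructor
    · intro h
      have := this.2 fun i hi => by linarith [h i hi]
      linarith
    · intro h i hi
      have := this.1 (by linarith) i hi
      linarith
  rw [key, hx]
  rw [show ∀ A B C D E : ℝ, A + B + C - B + D + E = A + E + D + C by intros; ring,
    ← max_add_add_right]
  congr 3 <;> ring

/-- `c` is the supremum of the linear functional `(f, g)` on `S`. -/
def HasSup (S : Set (ℝ × ℝ)) (f g c : ℝ) : Prop :=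
  ∀ C, (∀ p ∈ S, f * p.1 + g * p.2 ≤ C) ↔ c ≤ C

theorem forall_prefix_iff (f g C : ℝ) (w : Word) :
    (∀ u, u <+: w → ph f g u ≤ C) ↔ mx f g w ≤ C := by
  induction w generalizing C with
  | nil => simp [mx, ph]
  | cons l w ih =>
    rw [mx, max_le_iff, ← le_sub_iff_add_le', ← ih]
    constructor
    · refine fun h => ⟨by simpa [ph] using h [] (by simp), fun u hu => ?_⟩
      have := h (l :: u) (by simpa using hu)
      rw [ph_cons] at this
      linarith
    · rintro ⟨h0, h⟩ u hu
      rcases List.prefix_cons_iff.1 hu with rfl | ⟨t, rfl, ht⟩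
      · simpa [ph] using h0
      · rw [ph_cons]
        linarith [h t ht]

theorem hasSup_trace (W : F) (f g : ℝ) : HasSup (trace W) f g (mx f g W.toWord) := by
  intro C
  rw [← forall_prefix_iff]
  constructor
  · intro h u hu
    rw [ph_eq]
    exact h _ ⟨u, hu, rfl⟩
  · rintro h _ ⟨u, hu, rfl⟩
    rw [← ph_eq]
    exact h u hu

theorem convex_le (f g C : ℝ) : Convex ℝ {p : ℝ × ℝ | f * p.1 + g * p.2 ≤ C} :=
  convex_halfSpace_le (f := fun p : ℝ × ℝ => f * p.1 + g * p.2)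
    ⟨fun x y => by simp; ring, fun c x => by simp; ring⟩ C

theorem HasSup.convexHull {S : Set (ℝ × ℝ)} {f g c : ℝ} (h : HasSup S f g c) :
    HasSup (convexHull ℝ S) f g c := fun C => by
  rw [← h C]
  exact ⟨fun hC p hp => hC p (subset_convexHull ℝ S hp),
    fun hC p hp => convexHull_min hC (convex_le f g C) hp⟩

theorem hasSup_segment_add (x y : ℝ × ℝ) (f g : ℝ) :
    HasSup (segment ℝ x y + unitSquare) f g
      (max (f * x.1 + g * x.2) (f * y.1 + g * y.2) + max f 0 + max g 0) := by
  have hI : ∀ f t : ℝ, 0 ≤ t → t ≤ 1 → f * t ≤ max f 0 := fun f t h0 h1 => by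
    rcases le_total 0 f with h | h
    · exact le_max_of_le_left (by nlinarith)
    · exact le_max_of_le_right (by nlinarith)
  have hatt : ∀ f : ℝ, ∃ t : ℝ, (0 ≤ t ∧ t ≤ 1) ∧ f * t = max f 0 := fun f => by
    rcases le_total 0 f with h | h
    · exact ⟨1, by norm_num, by rw [max_eq_left h, mul_one]⟩
    · exact ⟨0, by norm_num, by rw [max_eq_right h, mul_zero]⟩
  intro C
  constructor
  · intro h
    obtain ⟨s, hs, hs'⟩ := hatt f
    obtain ⟨t, ht, ht'⟩ := hatt g
    have hst : (s, t) ∈ unitSquare := ⟨hs, ht⟩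
    have h1 := h _ (Set.add_mem_add (left_mem_segment ℝ x y) hst)
    have h2 := h _ (Set.add_mem_add (right_mem_segment ℝ x y) hst)
    simp only [Prod.fst_add, Prod.snd_add] at h1 h2
    rw [← max_add_add_right, ← max_add_add_right, ← hs', ← ht']
    exact max_le (by linarith) (by linarith)
  · rintro h _ ⟨p, hp, ⟨s, t⟩, ⟨hs, ht⟩, rfl⟩
    have h1 : f * p.1 + g * p.2 ≤ max (f * x.1 + g * x.2) (f * y.1 + g * y.2) :=
      (convex_le f g _).segment_subset (Set.mem_ofPred.2 (le_max_left _ _))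
        (Set.mem_ofPred.2 (le_max_right _ _)) hp
    have h2 := hI f s hs.1 hs.2
    have h3 := hI g t ht.1 ht.2
    simp only [Prod.fst_add, Prod.snd_add]
    linarith

theorem subset_of_hasSup {A B : Set (ℝ × ℝ)} (hA : Convex ℝ A) (hA' : IsClosed A)
    (h : ∀ f g, ∃ c, HasSup A f g c ∧ HasSup B f g c) : B ⊆ A := by
  intro p hp
  by_contra hpA
  obtain ⟨L, u, h1, h2⟩ := geometric_hahn_banach_closed_point hA hA' hpA
  have hL : ∀ q : ℝ × ℝ, L q = L (1, 0) * q.1 + L (0, 1) * q.2 := fun q => by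
    conv_lhs => rw [show q = q.1 • ((1, 0) : ℝ × ℝ) + q.2 • ((0, 1) : ℝ × ℝ) by ext <;> simp]
    rw [_root_.map_add, map_smul, map_smul, smul_eq_mul, smul_eq_mul]
    ring
  obtain ⟨c, hc, hc'⟩ := h (L (1, 0)) (L (0, 1))
  have h3 := (hc' u).2 ((hc u).1 fun q hq => by rw [← hL]; exact (h1 q hq).le) p hp
  rw [← hL] at h3
  linarith

theorem finite_trace (W : F) : (trace W).Finite := by
  refine ((List.finite_toSet W.toWord.inits).image
    fun u => (((aSum u : ℤ) : ℝ), ((bSum u : ℤ) : ℝ))).subset ?_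
  rintro _ ⟨u, hu, rfl⟩
  exact ⟨u, (List.mem_inits _ _).2 hu, rfl⟩

theorem convexHull_trace_eq_iff (W : F) :
    (∃ x y : ℝ × ℝ, convexHull ℝ (trace W) = segment ℝ x y + unitSquare) ↔
      ∃ d, LineRep d W.toWord := by
  constructor
  · rintro ⟨x, y, h⟩
    refine ⟨y - x, x, fun f g => ?_⟩
    have h1 := (hasSup_trace W f g).convexHull
    rw [h] at h1
    refine eq_of_forall_ge_iff fun C => ?_
    rw [← h1 C, hasSup_segment_add x y f g C]
    simp
  · rintro ⟨d, x, h⟩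
    have hsup : ∀ f g, ∃ c, HasSup (convexHull ℝ (trace W)) f g c ∧
        HasSup (segment ℝ x (x + d) + unitSquare) f g c := fun f g =>
      ⟨_, (hasSup_trace W f g).convexHull, by
        rw [h]
        exact hasSup_segment_add x (x + d) f g⟩
    have hsq : IsCompact unitSquare := isCompact_Icc.prod isCompact_Icc
    have hsq' : Convex ℝ unitSquare := (convex_Icc 0 1).prod (convex_Icc 0 1)
    have hseg : IsCompact (segment ℝ x (x + d)) := by
      rw [segment_eq_image_lineMap]
      exact isCompact_Icc.image AffineMap.lineMap_continuous
    refine ⟨x, x + d, Set.Subset.antisymm ?_ ?_⟩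
    · exact subset_of_hasSup ((convex_segment x (x + d)).add hsq') (hseg.add hsq).isClosed
        fun f g => (hsup f g).imp fun _ => And.symm
    · exact subset_of_hasSup (convex_convexHull ℝ _)
        ((finite_trace W).isCompact_convexHull (𝕜 := ℝ)).isClosed hsup

theorem exists_prefix_eq_mx (f g : ℝ) (w : Word) : ∃ u v, u ++ v = w ∧ ph f g u = mx f g w := by
  induction w with
  | nil => exact ⟨[], [], rfl, rfl⟩
  | cons l w ih =>
    obtain ⟨u, v, rfl, h⟩ := ih
    rw [mx]
    rcases le_total 0 (lv f g l + mx f g (u ++ v)) with h0 | h0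
    · exact ⟨l :: u, v, rfl, by rw [ph_cons, h, max_eq_right h0]⟩
    · exact ⟨[], l :: (u ++ v), rfl, by rw [max_eq_left h0]; rfl⟩

theorem exists_lattice_eq_mx (f g : ℝ) (w : Word) :
    ∃ m n : ℤ, f * m + g * n = mx f g w ∧ ∀ f' g' : ℝ, f' * m + g' * n ≤ mx f' g' w := by
  obtain ⟨u, v, rfl, h⟩ := exists_prefix_eq_mx f g w
  refine ⟨aSum u, bSum u, by rw [← ph_eq, h], fun f' g' => ?_⟩
  rw [← ph_eq]
  exact (forall_prefix_iff f' g' _ _).2 le_rfl u (List.prefix_append u v)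

theorem LineRep.neg {d : ℝ × ℝ} {w : Word} (h : LineRep d w) : LineRep (-d) w := by
  obtain ⟨x, hx⟩ := h
  refine ⟨x + d, fun f g => ?_⟩
  rw [hx, max_comm]
  simp

theorem LineRep.exists_int {d : ℝ × ℝ} {w : Word} (h : LineRep d w) :
    ∃ m n : ℤ, d = ((m : ℝ), (n : ℝ)) := by
  wlog hd : 0 ≤ d.1 generalizing d
  · obtain ⟨m, n, hmn⟩ := this h.neg (by simp; linarith)
    refine ⟨-m, -n, ?_⟩
    rw [← neg_neg d, hmn]
    simp
  obtain ⟨⟨x1, x2⟩, hx⟩ := h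
  obtain ⟨d1, d2⟩ := d
  simp only at hx hd
  have e1 := hx 1 0
  have e2 := hx (-1) 0
  have e3 := hx 0 1
  have e4 := hx 0 (-1)
  rcases le_total 0 d2 with h2 | h2
  · obtain ⟨m, n, hmn, hle⟩ := exists_lattice_eq_mx 1 1 w
    obtain ⟨m', n', hmn', hle'⟩ := exists_lattice_eq_mx (-1) (-1) w
    have l1 := hle 1 0
    have l2 := hle 0 1
    have l3 := hle' (-1) 0
    have l4 := hle' 0 (-1)
    rw [hx, max_eq_right (by linarith)] at hmn
    rw [hx, max_eq_left (by linarith)] at hmn'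
    rw [e1, max_eq_right (by linarith)] at l1
    rw [e3, max_eq_right (by linarith)] at l2
    rw [e2, max_eq_left (by linarith)] at l3
    rw [e4, max_eq_left (by linarith)] at l4
    norm_num at *
    refine ⟨⟨m - 1 - m', ?_⟩, ⟨n - 1 - n', ?_⟩⟩ <;> push_cast <;> linarith
  · obtain ⟨m, n, hmn, hle⟩ := exists_lattice_eq_mx 1 (-1) w
    obtain ⟨m', n', hmn', hle'⟩ := exists_lattice_eq_mx (-1) 1 w
    have l1 := hle 1 0
    have l2 := hle 0 (-1)
    have l3 := hle' (-1) 0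
    have l4 := hle' 0 1
    rw [hx, max_eq_right (by linarith)] at hmn
    rw [hx, max_eq_left (by linarith)] at hmn'
    rw [e1, max_eq_right (by linarith)] at l1
    rw [e4, max_eq_right (by linarith)] at l2
    rw [e2, max_eq_left (by linarith)] at l3
    rw [e3, max_eq_left (by linarith)] at l4
    norm_num at *
    refine ⟨⟨m - 1 - m', ?_⟩, ⟨n - (n' - 1), ?_⟩⟩ <;> push_cast <;> linarith

theorem LineG.exists_horizontal (N : ℕ) : ∀ (m n : ℤ) (W : F), m.natAbs = N → W ∈ commutator F →
    Full W → LineG ((m : ℝ), (n : ℝ)) W → ∃ (α : F ≃* F) (m' : ℝ), LineG (m', 0) (α W) := by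
  induction N using Nat.strong_induction_on with
  | _ N ih =>
    intro m n W hm hW hF h
    rcases eq_or_ne m 0 with rfl | hm0
    · exact ⟨TwoGen.sw, n, by simpa using h.sw⟩
    · have h1 := (h.tv hW (hF.num_pos 0) (-(n / m))).sw
      have hlt : (n % m).natAbs < N := by
        have := Int.emod_nonneg n hm0
        have := Int.emod_lt_abs n hm0
        rw [← Int.natCast_natAbs] at this
        omega
      obtain ⟨α, m', h2⟩ := ih _ hlt (n % m) m _ rfl
        (map_mem_commutator TwoGen.sw (map_mem_commutator (TwoGen.tv (-(n / m))) hW))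
        ((hF.map _).map _) (by
          convert h1 using 1
          rw [Int.emod_def]
          push_cast
          simp
          ring)
      exact ⟨(TwoGen.tv (-(n / m))).trans (TwoGen.sw.trans α), m', h2⟩

theorem mem_of_mx_le (w : Word) (h1 : mx 0 1 w ≤ 0) (h2 : mx 0 (-1) w ≤ 1) :
    (bSum w = 0 ∧ FreeGroup.mk w ∈ H) ∨ (bSum w = -1 ∧ FreeGroup.mk w * b ∈ H) := by
  have ha : a ∈ H := Subgroup.subset_closure (by simp)
  have hb : b⁻¹ * a * b ∈ H := Subgroup.subset_closure (by simp)
  induction w using List.reverseRecOn with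
  | nil => exact Or.inl ⟨rfl, one_mem H⟩
  | append_singleton w l ih =>
    have p1 := (ph_le_mx _ _ _).trans h1
    have p2 := (ph_le_mx _ _ _).trans h2
    rw [mx_append, max_le_iff] at h1 h2
    have hsum : bSum (w ++ [l]) = bSum w + bSum [l] := by simp [bSum]
    rw [ph_eq] at p1 p2
    simp only [zero_mul, zero_add, one_mul, neg_mul] at p1 p2
    have q1 : bSum (w ++ [l]) ≤ 0 := by exact_mod_cast p1
    have q2 : -bSum (w ++ [l]) ≤ 1 := by exact_mod_cast p2
    rw [hsum] at q1 q2 ⊢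
    rw [← FreeGroup.mul_mk]
    obtain ⟨i, s⟩ := l
    fin_cases i
    · have h0 : bSum [((0 : Fin 2), s)] = 0 := by simp [bSum]
      simp only [Fin.zero_eta, mk_letter_a, h0, add_zero]
      rcases ih h1.1 h2.1 with ⟨e, hm⟩ | ⟨e, hm⟩
      · exact Or.inl ⟨e, mul_mem hm (zpow_mem ha _)⟩
      · refine Or.inr ⟨e, ?_⟩
        have := mul_mem hm (zpow_mem hb (cond s 1 (-1)))
        rw [show b⁻¹ * a * b = b⁻¹ * a * b⁻¹⁻¹ by rw [inv_inv], conj_zpow] at this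
        simpa [mul_assoc] using this
    · have h0 : bSum [((1 : Fin 2), s)] = cond s 1 (-1) := by cases s <;> simp [bSum]
      simp only [Fin.mk_one, mk_letter_b, h0] at q1 q2 ⊢
      rcases ih h1.1 h2.1 with ⟨e, hm⟩ | ⟨e, hm⟩
      · cases s
        · exact Or.inr (by simpa [e] using hm)
        · simp [e] at q1
      · cases s
        · simp [e] at q2
        · exact Or.inl (by simpa [e] using hm)

theorem LineG.exists_mem {m : ℝ} {W : F} (hW : W ∈ commutator F) (h : LineG (m, 0) W) :
    ∃ w, IsRep W w ∧ FreeGroup.mk w ∈ H := by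
  obtain ⟨w, hw, x, hx⟩ := h
  obtain ⟨u, v, rfl, hu⟩ := exists_prefix_eq_mx 0 1 w
  have hp := ph_eq_zero hW hw
  have h1 := mx_append_comm (hp 0 1)
  have h2 := mx_append_comm (hp 0 (-1))
  have h3 : ph 0 (-1) u = -ph 0 1 u := by
    rw [ph_eq, ph_eq]
    ring
  have e1 := hx 0 1
  have e2 := hx 0 (-1)
  norm_num at e1 e2
  have hr := hw.append_comm
  refine ⟨v ++ u, hr, ?_⟩
  rcases mem_of_mx_le (v ++ u) (by linarith) (by linarith) with ⟨-, h⟩ | ⟨h, -⟩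
  · exact h
  · have := ph_eq_zero hW hr 0 1
    rw [ph_eq, h] at this
    norm_num at this

theorem exists_shortest_mem {W : F} (hW : W ∈ commutator F) (hF : Full W) {d : ℝ × ℝ}
    (h : LineG d W) : ∃ T : F, (∃ α : F ≃* F, α W = T) ∧
      (∀ α : F ≃* F, FreeGroup.norm T ≤ FreeGroup.norm (α W)) ∧ T ∈ H := by
  obtain ⟨m, n, rfl⟩ : ∃ m n : ℤ, d = ((m : ℝ), (n : ℝ)) := by
    obtain ⟨w, -, hw⟩ := h
    exact hw.exists_int
  obtain ⟨α, m', hα⟩ := LineG.exists_horizontal _ m n W rfl hW hF h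
  obtain ⟨w, hw, hT⟩ := hα.exists_mem (map_mem_commutator α hW)
  obtain ⟨g, hg⟩ := isConj_iff.1 hw.2
  have hγ : (α.trans (MulAut.conj g)) W = FreeGroup.mk w := by simp [hg]
  have hF' : Full (FreeGroup.mk w) := hγ ▸ hF.map _
  refine ⟨_, ⟨_, hγ⟩, fun β => ?_, hT⟩
  have h1 := num_le_of_mem hT hF' ((α.trans (MulAut.conj g)).symm.trans β)
  have h2 : ((α.trans (MulAut.conj g)).symm.trans β) (FreeGroup.mk w) = β W := by
    rw [← hγ, MulEquiv.trans_apply, MulEquiv.symm_apply_apply]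
  rw [h2] at h1
  rw [hw.norm_mk, num_conj hw.2, num_conj hw.2]
  exact h1.trans (num_add_num_le_norm _)

theorem exists_lineG_map {W : F} (hW : W ∈ commutator F) (hF : Full W) (h : ∃ d, LineG d W)
    (α : F ≃* F) : ∃ d, LineG d (α W) := by
  refine (aut_induction (P := fun W => W ∈ commutator F ∧ Full W ∧ ∃ d, LineG d W) ?_ α
    ⟨hW, hF, h⟩).2.2
  rintro W ⟨hW, hF, d, h⟩ α hα
  suffices (∃ d, LineG d (α W)) ∧ ∃ d, LineG d (α.symm W) from
    ⟨⟨map_mem_commutator _ hW, hF.map _, this.1⟩, ⟨map_mem_commutator _ hW, hF.map _, this.2⟩⟩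
  cases hα with
  | sw => exact ⟨⟨_, h.sw⟩, ⟨_, h.sw⟩⟩
  | fa => exact ⟨⟨_, h.fa⟩, ⟨_, h.fa⟩⟩
  | tv =>
    refine ⟨⟨_, h.tv hW (hF.num_pos 0) 1⟩, ?_⟩
    have e : (tv 1).symm W = tv (-1) W := by
      rw [MulEquiv.symm_apply_eq, tv_tv]
      simp
    rw [e]
    exact ⟨_, h.tv hW (hF.num_pos 0) (-1)⟩
  | conj g =>
    exact ⟨⟨d, h.conj (isConj_iff.2 ⟨g⁻¹, by simp [mul_assoc]⟩)⟩,
      ⟨d, h.conj (isConj_iff.2 ⟨g, by simp [mul_assoc]⟩)⟩⟩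

theorem lt_eq_of_slope_eq_zero {e : ℕ → Bool} (k : ℕ → ℤ) {n : ℕ} (h : ∀ i < n, slope e i = 0)
    (f g : ℝ) {i : ℕ} (hi : i ≤ n) :
    lt e k f g i = g * (∑ j ∈ Finset.range i, k j : ℤ) - cond (e 0) 0 1 * f := by
  induction i with
  | zero => simp [lt, pt]
  | succ i ih =>
    have h1 := ih (by omega)
    have h2 := h i (by omega)
    rw [lt] at h1 ⊢
    rw [pt, Finset.sum_range_succ]
    push_cast at h1 ⊢
    rw [slope] at h2
    cases h3 : e i <;> cases h4 : e (i + 1) <;> simp [h3, h4] at h1 h2 ⊢ <;> linarith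

theorem exists_lineG_of_mem {T : F} (hT : T ∈ H) (hT' : T ∈ commutator F) (hF : Full T) :
    ∃ d, LineG d (sw T) := by
  obtain ⟨n, e, k, hb, hr, hk⟩ := exists_isBlock_of_mem hT (hF.num_pos 1)
  have hlt := fun f g i (hi : i < n) =>
    lt_eq_of_slope_eq_zero k (fun i hi => (hk i hi).1) f g hi.le
  have hmx := fun f g => hb.mx_le (ph_eq_zero (map_mem_commutator sw hT') hr f g)
  have hn : 1 < n := by
    have h0 := hb.pos
    by_contra hcon
    obtain rfl : n = 1 := by omega
    have h1 := (hk 0 one_pos).1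
    have h2 := hb.closed
    rw [slope, zero_add, h2] at h1
    cases h : e 0 <;> simp [h] at h1
  set K : ℕ → ℤ := fun i => ∑ j ∈ Finset.range i, k j with hK
  have hne : (Finset.range n).Nonempty := ⟨0, by simp; omega⟩
  obtain ⟨i, hi, hmin⟩ := Finset.exists_min_image (Finset.range n) K hne
  obtain ⟨j, hj, hmax⟩ := Finset.exists_max_image (Finset.range n) K hne
  rw [Finset.mem_range] at hi hj
  have hij : K i + 1 ≤ K j := by
    have h1 := hmin 0 (by simp; omega)
    have h2 := hmin 1 (by simpa)
    have h3 := hmax 0 (by simp; omega)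
    have h4 := hmax 1 (by simpa)
    have h5 := (hk 0 (by omega)).2
    have h6 : K 0 = 0 := by simp [hK]
    have h7 : K 1 = k 0 := by simp [hK]
    omega
  have hij' : (K i : ℝ) + 1 ≤ K j := by exact_mod_cast hij
  refine ⟨(0, K j - 1 - K i), _, hr, (-cond (e 0) 0 1, K i), fun f g => ?_⟩
  refine eq_of_forall_ge_iff fun C => ?_
  rw [hmx]
  simp only
  have hbd : ∀ l < n, (K i : ℝ) ≤ K l ∧ (K l : ℝ) ≤ K j := fun l hl =>
    ⟨by exact_mod_cast hmin l (by simpa), by exact_mod_cast hmax l (by simpa)⟩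
  rcases le_total 0 g with hg | hg
  · rw [max_eq_right (a := f * _ + _) (by nlinarith), max_eq_left hg]
    constructor
    · intro h
      have := h j hj
      rw [hlt f g j hj] at this
      simp only [hK] at this ⊢
      linarith
    · intro h l hl
      rw [hlt f g l hl]
      have := mul_le_mul_of_nonneg_left (hbd l hl).2 hg
      simp only [hK] at this h ⊢
      linarith
  · rw [max_eq_left (a := f * _ + _) (by nlinarith), max_eq_right hg]
    constructor
    · intro h
      have := h i hi
      rw [hlt f g i hi] at this
      simp only [hK] at this ⊢
      linarith
    · intro h l hl
      rw [hlt f g l hl]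
      have := mul_le_mul_of_nonpos_left (hbd l hl).1 hg
      simp only [hK] at this h ⊢
      linarith

end TwoGen

/-- For a nontrivial cyclically reduced `R` in the commutator subgroup of `F(a,b)`:
the Friedl–Tillmann polytope of `⟨a,b | R⟩` is a straight line (possibly a point),
i.e. the convex hull of the trace of `R` is a Minkowski sum of a (possibly degenerate)
segment and the unit square, if and only if some shortest element of the
`Aut F(a,b)`-orbit of `R` lies in `⟨a, b⁻¹ab⟩`. -/
theorem polytope_line_iff_orbit_shortest_mem (R : F) (hR1 : R ≠ 1)
    (hRc : R ∈ commutator F) (hcr : IsCyclicallyReduced R) :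
    (∃ x y : ℝ × ℝ, convexHull ℝ (trace R) = segment ℝ x y + unitSquare) ↔
    (∃ T : F, (∃ α : F ≃* F, α R = T) ∧
      (∀ α : F ≃* F, FreeGroup.norm T ≤ FreeGroup.norm (α R)) ∧ T ∈ H) := by
  have hF := TwoGen.full_of_mem_commutator hRc hR1
  have hrep := TwoGen.isRep_toWord hcr
  rw [TwoGen.convexHull_trace_eq_iff]
  constructor
  · rintro ⟨d, hd⟩
    exact TwoGen.exists_shortest_mem hRc hF ⟨_, hrep, hd⟩
  · rintro ⟨T, ⟨α, rfl⟩, -, hT⟩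
    have hc := TwoGen.map_mem_commutator α hRc
    have hF' := hF.map α
    obtain ⟨d, w, hw, hd⟩ := TwoGen.exists_lineG_map (TwoGen.map_mem_commutator TwoGen.sw hc)
      (hF'.map TwoGen.sw) (TwoGen.exists_lineG_of_mem hT hc hF') (MulEquiv.trans TwoGen.sw α.symm)
    rw [MulEquiv.trans_apply, TwoGen.sw_sw, MulEquiv.symm_apply_apply] at hw
    exact ⟨d, hd.of_isRep hRc hw hrep⟩
end

section
/- Let R be a nontrivial cyclically reduced element of the commutator subgroup F(a,b)' of F(a,b). Then the convex hull of the trace of R is a translate of the unit square [0,1]×[0,1] if and only if R is conjugate in F(a,b) to [a,b]^k for some integer k. (This is the statement that the Friedl–Tillmann polytope of ⟨a,b | R⟩ is a single point if and only if R is conjugate to a power of the commutator.) -/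
open Pointwise

/-- The commutator `[a,b] = aba⁻¹b⁻¹`. -/
def commAB : F := a * b * a⁻¹ * b⁻¹

/-- The exponent-sum vector of a word. -/
def wordSum (w : List (Fin 2 × Bool)) : ℤ × ℤ := (aSum w, bSum w)

/-- The corners of the unit square, as lattice points. -/
def unitCorners : Finset (ℤ × ℤ) := {0, 1} ×ˢ {0, 1}

/-- The `i`-th corner met when walking around the unit square from the origin,
counterclockwise if `e` is true and clockwise otherwise. -/
def squareCorner (e : Bool) (i : ZMod 4) : ℤ × ℤ :=
  bif e then (![(0, 0), (1, 0), (1, 1), (0, 1)] : Fin 4 → ℤ × ℤ) i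
  else (![(0, 0), (0, 1), (1, 1), (1, 0)] : Fin 4 → ℤ × ℤ) i

/-- The letter read along the edge from `squareCorner e i` to `squareCorner e (i + 1)`. -/
def squareLetter (e : Bool) (i : ZMod 4) : Fin 2 × Bool :=
  bif e then (![(0, true), (1, true), (0, false), (1, false)] : Fin 4 → Fin 2 × Bool) i
  else (![(1, true), (0, true), (1, false), (0, false)] : Fin 4 → Fin 2 × Bool) i

/-- The word read along the walk of length `n` around the unit square starting at
`squareCorner e i`. -/
def squareWalk (e : Bool) : ZMod 4 → ℕ → List (Fin 2 × Bool)
  | _, 0 => []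
  | i, n + 1 => squareLetter e i :: squareWalk e (i + 1) n

theorem wordSum_cons (x : Fin 2 × Bool) (w : List (Fin 2 × Bool)) :
    wordSum (x :: w) = wordSum [x] + wordSum w := by
  simp [wordSum, aSum, bSum]

theorem wordSum_nil : wordSum [] = 0 := rfl

theorem squareCorner_add_one (e : Bool) (i : ZMod 4) :
    squareCorner e (i + 1) = squareCorner e i + wordSum [squareLetter e i] := by
  decide +revert

theorem squareCorner_injective (e : Bool) : Function.Injective (squareCorner e) := by
  unfold Function.Injective
  decide +revert

theorem squareCorner_mem (e : Bool) (i : ZMod 4) : squareCorner e i ∈ unitCorners := by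
  decide +revert

theorem exists_squareCorner_eq (e : Bool) {p : ℤ × ℤ} (hp : p ∈ unitCorners) :
    ∃ i, squareCorner e i = p := by
  revert p e
  decide

theorem squareLetter_isReduced (e : Bool) (i : ZMod 4) :
    (squareLetter e i).1 = (squareLetter e (i + 1)).1 →
      (squareLetter e i).2 = (squareLetter e (i + 1)).2 := by
  decide +revert

theorem exists_squareLetter_eq {p : ℤ × ℤ} (hp : p ∈ unitCorners) (x : Fin 2 × Bool)
    (hx : p + wordSum [x] ∈ unitCorners) :
    ∃ e i, squareCorner e i = p ∧ squareLetter e i = x := by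
  revert p x
  decide

theorem eq_squareLetter_add_one (e : Bool) (i : ZMod 4) (x : Fin 2 × Bool)
    (hx : squareCorner e (i + 1) + wordSum [x] ∈ unitCorners)
    (hr : (squareLetter e i).1 = x.1 → (squareLetter e i).2 = x.2) :
    x = squareLetter e (i + 1) := by
  revert e i x
  decide

theorem length_squareWalk (e : Bool) (i : ZMod 4) (n : ℕ) : (squareWalk e i n).length = n := by
  induction n generalizing i with
  | zero => rfl
  | succ n ih => simp [squareWalk, ih]

theorem squareWalk_add (e : Bool) (i : ZMod 4) (m n : ℕ) :
    squareWalk e i (m + n) = squareWalk e i m ++ squareWalk e (i + m) n := by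
  induction m generalizing i with
  | zero => simp [squareWalk]
  | succ m ih =>
    rw [Nat.add_right_comm]
    simp only [squareWalk, ih, List.cons_append, Nat.cast_add, Nat.cast_one]
    rw [add_assoc i 1, add_comm (1 : ZMod 4)]

theorem squareWalk_succ (e : Bool) (i : ZMod 4) (n : ℕ) :
    squareWalk e i (n + 1) = squareWalk e i n ++ [squareLetter e (i + n)] :=
  squareWalk_add e i n 1

theorem squareWalk_isReduced (e : Bool) (i : ZMod 4) (n : ℕ) :
    FreeGroup.IsReduced (squareWalk e i n) := by
  induction n generalizing i with
  | zero => exact .nil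
  | succ n ih =>
    cases n with
    | zero => exact .singleton
    | succ n => exact FreeGroup.isReduced_cons_cons.2 ⟨squareLetter_isReduced e i, ih (i + 1)⟩

theorem wordSum_squareWalk (e : Bool) (i : ZMod 4) (n : ℕ) :
    squareCorner e i + wordSum (squareWalk e i n) = squareCorner e (i + n) := by
  induction n generalizing i with
  | zero => simp [squareWalk, wordSum_nil]
  | succ n ih =>
    rw [squareWalk, wordSum_cons, ← add_assoc, ← squareCorner_add_one, ih]
    congr 1
    push_cast
    ring

theorem eq_squareWalk_of_prefix {e : Bool} {i : ZMod 4} {n : ℕ} {u : List (Fin 2 × Bool)}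
    (hu : u <+: squareWalk e i n) : u = squareWalk e i u.length := by
  have hle : u.length ≤ n := by simpa [length_squareWalk] using hu.length_le
  have hw : squareWalk e i u.length <+: squareWalk e i n := by
    obtain ⟨k, rfl⟩ := Nat.exists_eq_add_of_le hle
    rw [squareWalk_add]
    exact List.prefix_append _ _
  exact (List.prefix_of_prefix_length_le hu hw (length_squareWalk ..).ge).eq_of_length
    (length_squareWalk ..).symm

/-- A reduced word that continues an edge of the unit square without leaving the corners of the
square keeps walking around it. -/
theorem eq_squareWalk_of_isReduced_cons {e : Bool} {w : List (Fin 2 × Bool)} {i : ZMod 4}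
    (hr : FreeGroup.IsReduced (squareLetter e i :: w))
    (hw : ∀ u, u <+: w → squareCorner e (i + 1) + wordSum u ∈ unitCorners) :
    w = squareWalk e (i + 1) w.length := by
  induction w generalizing i with
  | nil => rfl
  | cons x w ih =>
    obtain ⟨hx, hr⟩ := FreeGroup.isReduced_cons_cons.1 hr
    obtain rfl := eq_squareLetter_add_one e i x (hw [x] (by simp)) hx
    rw [List.length_cons, squareWalk, ← ih hr]
    intro u hu
    have := hw (squareLetter e (i + 1) :: u) (by simpa using hu)
    rwa [wordSum_cons, ← add_assoc, ← squareCorner_add_one] at this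

theorem exists_eq_squareWalk {w : List (Fin 2 × Bool)} {p : ℤ × ℤ}
    (hr : FreeGroup.IsReduced w) (hw : ∀ u, u <+: w → p + wordSum u ∈ unitCorners) :
    ∃ e i, w = squareWalk e i w.length := by
  cases w with
  | nil => exact ⟨true, 0, rfl⟩
  | cons x w =>
    have hp : p ∈ unitCorners := by simpa [wordSum_nil] using hw [] (by simp)
    obtain ⟨e, i, rfl, rfl⟩ := exists_squareLetter_eq hp x (hw [x] (by simp))
    refine ⟨e, i, ?_⟩
    rw [List.length_cons, squareWalk, ← eq_squareWalk_of_isReduced_cons hr]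
    intro u hu
    have := hw (squareLetter e i :: u) (by simpa using hu)
    rwa [wordSum_cons, ← add_assoc, ← squareCorner_add_one] at this

theorem wordSum_toWord_of_mem_commutator {R : F} (hR : R ∈ commutator F) :
    wordSum R.toWord = 0 := by
  let φ : F →* Multiplicative (ℤ × ℤ) :=
    FreeGroup.lift fun x => Multiplicative.ofAdd (wordSum [(x, true)])
  have key (w : List (Fin 2 × Bool)) : φ (FreeGroup.mk w) = Multiplicative.ofAdd (wordSum w) := by
    induction w with
    | nil => simp [← FreeGroup.one_eq_mk, wordSum_nil]
    | cons x w ih =>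
      rw [← List.singleton_append, ← FreeGroup.mul_mk, map_mul, ih, List.singleton_append,
        wordSum_cons x w, ofAdd_add]
      congr 1
      revert x
      simp only [φ, FreeGroup.lift_mk]
      decide
  have h1 : φ R = 1 := Abelianization.commutator_subset_ker φ hR
  rw [← FreeGroup.mk_toWord (x := R), key] at h1
  exact h1

theorem real_mem_unitCorners {p : ℤ × ℤ} :
    p ∈ unitCorners ↔ ((p.1 : ℝ), (p.2 : ℝ)) ∈ ({0, 1} : Set ℝ) ×ˢ ({0, 1} : Set ℝ) := by
  simp only [unitCorners, Finset.mem_product, Finset.mem_insert, Finset.mem_singleton,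
    Set.mem_prod, Set.mem_insert_iff, Set.mem_singleton_iff]
  norm_cast

theorem singleton_add_unitSquare (v : ℝ × ℝ) :
    {v} + unitSquare = Set.Icc v.1 (v.1 + 1) ×ˢ Set.Icc v.2 (v.2 + 1) := by
  ext ⟨x, y⟩
  simp only [unitSquare, Set.singleton_add, Set.image_add_left, Set.mem_preimage, Set.mem_prod,
    Set.mem_Icc, Prod.fst_add, Prod.snd_add, Prod.fst_neg, Prod.snd_neg]
  constructor <;> rintro ⟨⟨_, _⟩, _, _⟩ <;> refine ⟨⟨?_, ?_⟩, ?_, ?_⟩ <;> linarith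

theorem convexHull_corners : convexHull ℝ (({0, 1} : Set ℝ) ×ˢ ({0, 1} : Set ℝ)) = unitSquare := by
  rw [convexHull_prod, convexHull_pair, segment_eq_Icc zero_le_one, unitSquare]

theorem convexHull_trace_of_squareWalk {R : F} {e : Bool} {i : ZMod 4} {n : ℕ} (hn : 3 ≤ n)
    (hR : R.toWord = squareWalk e i n) : ∃ v : ℝ × ℝ, convexHull ℝ (trace R) = {v} + unitSquare := by
  set c := squareCorner e i with hc
  have ht : trace R = {(-(c.1 : ℝ), -(c.2 : ℝ))} + ({0, 1} : Set ℝ) ×ˢ ({0, 1} : Set ℝ) := by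
    ext p
    rw [Set.singleton_add, Set.mem_image]
    constructor
    · rintro ⟨u, hu, rfl⟩
      rw [hR] at hu
      have hs := wordSum_squareWalk e i u.length
      rw [← eq_squareWalk_of_prefix hu] at hs
      refine ⟨_, real_mem_unitCorners.1 (squareCorner_mem e (i + u.length)), ?_⟩
      rw [← hs, ← hc]
      simp [wordSum]
    · rintro ⟨q, hq, rfl⟩
      obtain ⟨q, rfl⟩ : ∃ z : ℤ × ℤ, q = ((z.1 : ℝ), (z.2 : ℝ)) := by
        obtain ⟨x, y⟩ := q
        rcases hq with ⟨h1 | h1, h2 | h2⟩ <;> simp only [Set.mem_singleton_iff] at h1 h2 <;>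
          subst h1 h2
        exacts [⟨(0, 0), by simp⟩, ⟨(0, 1), by simp⟩, ⟨(1, 0), by simp⟩, ⟨(1, 1), by simp⟩]
      obtain ⟨j, rfl⟩ := exists_squareCorner_eq e (real_mem_unitCorners.2 hq)
      have hlt : (j - i).val ≤ n := (Nat.le_of_lt_succ (ZMod.val_lt (j - i))).trans hn
      refine ⟨squareWalk e i (j - i).val, ?_, ?_⟩
      · obtain ⟨k, rfl⟩ := Nat.exists_eq_add_of_le hlt
        rw [hR, squareWalk_add]
        exact List.prefix_append _ _
      · have hs := wordSum_squareWalk e i (j - i).val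
        rw [ZMod.natCast_val, ZMod.cast_id, add_sub_cancel, ← hc] at hs
        rw [← hs]
        simp [wordSum]
  exact ⟨_, by rw [ht, convexHull_add, convexHull_singleton, convexHull_corners]⟩

theorem exists_toWord_eq_squareWalk {R : F} (hRc : R ∈ commutator F) {v : ℝ × ℝ}
    (hv : convexHull ℝ (trace R) = {v} + unitSquare) :
    ∃ e i n, R.toWord = squareWalk e i (4 * n) := by
  have hvt : v ∈ trace R := by
    refine extremePoints_convexHull_subset (𝕜 := ℝ) ?_
    rw [hv, singleton_add_unitSquare, extremePoints_prod, Set.extremePoints_Icc (by linarith),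
      Set.extremePoints_Icc (by linarith)]
    simp
  obtain ⟨u₀, -, hu₀⟩ := hvt
  obtain ⟨e, i, hw⟩ := exists_eq_squareWalk (p := -wordSum u₀)
    (FreeGroup.isReduced_toWord (x := R)) fun u hu => by
      have hmem : ((aSum u : ℝ), (bSum u : ℝ)) ∈ convexHull ℝ (trace R) :=
        subset_convexHull ℝ _ ⟨u, hu, rfl⟩
      rw [hv, singleton_add_unitSquare, hu₀] at hmem
      obtain ⟨⟨h1, h2⟩, h3, h4⟩ := hmem
      dsimp only at h1 h2 h3 h4
      norm_cast at h1 h2 h3 h4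
      simp only [unitCorners, wordSum, Finset.mem_product, Finset.mem_insert, Finset.mem_singleton,
        Prod.fst_add, Prod.snd_add, Prod.fst_neg, Prod.snd_neg]
      omega
  have hs := wordSum_squareWalk e i R.toWord.length
  rw [← hw, wordSum_toWord_of_mem_commutator hRc, add_zero] at hs
  obtain ⟨n, hn⟩ := (ZMod.natCast_eq_zero_iff _ 4).1
    (left_eq_add.1 (squareCorner_injective e hs))
  exact ⟨e, i, n, by rw [← hn]; exact hw⟩

theorem squareLetter_mul_mk_squareWalk (e : Bool) (i : ZMod 4) (n : ℕ) :
    FreeGroup.mk [squareLetter e i] * FreeGroup.mk (squareWalk e (i + 1) (4 * n)) =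
      FreeGroup.mk (squareWalk e i (4 * n)) * FreeGroup.mk [squareLetter e i] := by
  have h4 : (4 : ZMod 4) = 0 := rfl
  have h := squareWalk_succ e i (4 * n)
  rw [squareWalk, Nat.cast_mul, Nat.cast_ofNat, h4, zero_mul, add_zero] at h
  rw [FreeGroup.mul_mk, FreeGroup.mul_mk, ← h, List.singleton_append]

theorem isConj_mk_squareWalk_add_one (e : Bool) (i : ZMod 4) (n : ℕ) :
    IsConj (FreeGroup.mk (squareWalk e (i + 1) (4 * n)) : F)
      (FreeGroup.mk (squareWalk e i (4 * n))) :=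
  isConj_iff.2 ⟨_, by rw [squareLetter_mul_mk_squareWalk, mul_inv_cancel_right]⟩

theorem isConj_mk_squareWalk_zero (e : Bool) (i : ZMod 4) (n : ℕ) :
    IsConj (FreeGroup.mk (squareWalk e i (4 * n)) : F)
      (FreeGroup.mk (squareWalk e 0 (4 * n))) := by
  obtain ⟨m, rfl⟩ := ZMod.natCast_zmod_surjective i
  induction m with
  | zero => rw [Nat.cast_zero]
  | succ m ih =>
    rw [Nat.cast_succ]
    exact (isConj_mk_squareWalk_add_one e m n).trans ih

theorem mk_squareWalk_zero (e : Bool) (n : ℕ) :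
    (FreeGroup.mk (squareWalk e 0 (4 * n)) : F) = FreeGroup.mk (squareWalk e 0 4) ^ n := by
  induction n with
  | zero => rfl
  | succ n ih =>
    have h4 : (4 : ZMod 4) = 0 := rfl
    rw [Nat.mul_succ, squareWalk_add, ← FreeGroup.mul_mk, ih, pow_succ, Nat.cast_mul,
      Nat.cast_ofNat, h4, zero_mul, zero_add]

theorem mk_squareWalk_true : (FreeGroup.mk (squareWalk true 0 4) : F) = commAB := rfl

theorem mk_squareWalk_false : (FreeGroup.mk (squareWalk false 0 4) : F) = commAB⁻¹ := rfl

/-- A minimal-length conjugate of a closed walk around the unit square is again such a walk. -/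
theorem exists_toWord_conj_squareWalk {e : Bool} {n : ℕ} (h : F) (i : ZMod 4)
    (hcr : IsCyclicallyReduced (h * FreeGroup.mk (squareWalk e i (4 * (n + 1))) * h⁻¹)) :
    ∃ j, (h * FreeGroup.mk (squareWalk e i (4 * (n + 1))) * h⁻¹).toWord =
      squareWalk e j (4 * (n + 1)) := by
  induction hN : h.norm using Nat.strong_induction_on generalizing h i with
  | _ N ih =>
  subst hN
  rcases List.eq_nil_or_concat h.toWord with hnil | ⟨u, x, hu⟩
  · obtain rfl := FreeGroup.toWord_eq_nil_iff.1 hnil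
    refine ⟨i, ?_⟩
    simp [FreeGroup.toWord_mk, (squareWalk_isReduced e i _).reduce_eq]
  rw [List.concat_eq_append] at hu
  have hh : h = FreeGroup.mk u * FreeGroup.mk [x] := by
    rw [FreeGroup.mul_mk, ← hu, FreeGroup.mk_toWord]
  have hlt : (FreeGroup.mk u).norm < h.norm := by
    refine FreeGroup.norm_mk_le.trans_lt ?_
    rw [FreeGroup.norm, hu]
    simp
  set W := squareWalk e i (4 * (n + 1)) with hW
  have shorten (j : ZMod 4) (hj : FreeGroup.mk [x] * FreeGroup.mk W * (FreeGroup.mk [x])⁻¹ =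
      FreeGroup.mk (squareWalk e j (4 * (n + 1)))) :
      ∃ j, (h * FreeGroup.mk W * h⁻¹).toWord = squareWalk e j (4 * (n + 1)) := by
    have heq : h * FreeGroup.mk W * h⁻¹ =
        FreeGroup.mk u * FreeGroup.mk (squareWalk e j (4 * (n + 1))) * (FreeGroup.mk u)⁻¹ := by
      rw [← hj, hh]
      group
    rw [heq] at hcr ⊢
    exact ih _ hlt _ j hcr rfl
  by_cases hl : x.1 = (squareLetter e i).1 → x.2 = (squareLetter e i).2
  swap
  · refine shorten (i + 1) ?_
    have hx : FreeGroup.mk [x] = (FreeGroup.mk [squareLetter e i])⁻¹ := by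
      rw [FreeGroup.inv_mk, show x = ((squareLetter e i).1, !(squareLetter e i).2) by
        push Not at hl
        ext <;> grind]
      rfl
    rw [hx, inv_inv, hW, mul_assoc, ← squareLetter_mul_mk_squareWalk, inv_mul_cancel_left]
  by_cases hr : (squareLetter e (i - 1)).1 = x.1 → (squareLetter e (i - 1)).2 = !x.2
  swap
  · refine shorten (i - 1) ?_
    have hx : x = squareLetter e (i - 1) := by
      push Not at hr
      ext <;> grind
    have := squareLetter_mul_mk_squareWalk e (i - 1) (n + 1)
    rw [sub_add_cancel] at this
    rw [hx, hW, this, mul_inv_cancel_right]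
  exfalso
  have hWne : W ≠ [] := by simp [hW, ← List.length_pos_iff, length_squareWalk]
  have hWr : FreeGroup.IsReduced W := squareWalk_isReduced ..
  have hleft : FreeGroup.IsReduced (h.toWord ++ W) := by
    refine List.IsChain.append FreeGroup.isReduced_toWord hWr fun y hy z hz => ?_
    have hy' : y = x := by simpa [hu, eq_comm] using hy
    have hz' : z = squareLetter e i := by
      simpa [hW, Nat.mul_succ, squareWalk, eq_comm] using hz
    rw [hy', hz']
    exact hl
  have hright : FreeGroup.IsReduced (W ++ FreeGroup.invRev h.toWord) := by
    rw [← FreeGroup.toWord_inv]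
    refine List.IsChain.append hWr FreeGroup.isReduced_toWord fun y hy z hz => ?_
    have hz' : z = (x.1, !x.2) := by
      simpa [FreeGroup.toWord_inv, hu, FreeGroup.invRev, eq_comm] using hz
    have hc : i + ((4 * n + 3 : ℕ) : ZMod 4) = i - 1 := by
      have h4 : (4 : ZMod 4) = 0 := rfl
      have h3 : (3 : ZMod 4) = -1 := rfl
      push_cast
      rw [h4, h3, zero_mul, zero_add, sub_eq_add_neg]
    have hy' : y = squareLetter e (i - 1) := by
      rw [hW, show 4 * (n + 1) = (4 * n + 3) + 1 by ring, squareWalk_succ, hc] at hy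
      simpa [eq_comm] using hy
    rw [hy', hz']
    exact hr
  have hred := FreeGroup.IsReduced.append_overlap hleft hright hWne
  have hnorm : (h * FreeGroup.mk W * h⁻¹).norm =
      (h.toWord ++ W ++ FreeGroup.invRev h.toWord).length := by
    rw [FreeGroup.norm, ← hred.reduce_eq, ← FreeGroup.toWord_mk, ← FreeGroup.mul_mk,
      ← FreeGroup.mul_mk, ← FreeGroup.inv_mk, FreeGroup.mk_toWord]
  have hmin := hcr h⁻¹
  rw [hnorm, show h⁻¹ * (h * FreeGroup.mk W * h⁻¹) * h⁻¹⁻¹ = FreeGroup.mk W by group] at hmin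
  have hle : (FreeGroup.mk W).norm ≤ W.length := FreeGroup.norm_mk_le
  have hpos : 0 < h.toWord.length := by simp [hu]
  simp only [List.length_append] at hmin
  omega

theorem exists_toWord_eq_squareWalk_of_isConj {R : F} (hR1 : R ≠ 1) (hcr : IsCyclicallyReduced R)
    {k : ℤ} (hk : IsConj R (commAB ^ k)) :
    ∃ e i n, R.toWord = squareWalk e i (4 * (n + 1)) := by
  obtain ⟨e, n, hn⟩ : ∃ e n, (commAB ^ k : F) = FreeGroup.mk (squareWalk e 0 (4 * n)) := by
    obtain ⟨n, rfl | rfl⟩ := k.eq_nat_or_neg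
    · exact ⟨true, n, by rw [mk_squareWalk_zero, mk_squareWalk_true, zpow_natCast]⟩
    · exact ⟨false, n, by
        rw [mk_squareWalk_zero, mk_squareWalk_false, zpow_neg, zpow_natCast, inv_pow]⟩
  rw [hn] at hk
  obtain ⟨g, rfl⟩ := isConj_iff.1 hk.symm
  cases n with
  | zero => exact absurd (by simp [squareWalk, ← FreeGroup.one_eq_mk]) hR1
  | succ n =>
    obtain ⟨j, hj⟩ := exists_toWord_conj_squareWalk g 0 hcr
    exact ⟨e, j, n, hj⟩

theorem exists_isConj_of_toWord_eq_squareWalk {R : F} {e : Bool} {i : ZMod 4} {n : ℕ}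
    (hR : R.toWord = squareWalk e i (4 * n)) : ∃ k : ℤ, IsConj R (commAB ^ k) := by
  have h := isConj_mk_squareWalk_zero e i n
  rw [← hR, FreeGroup.mk_toWord, mk_squareWalk_zero] at h
  cases e with
  | true => exact ⟨n, by rwa [zpow_natCast, ← mk_squareWalk_true]⟩
  | false => exact ⟨-n, by rwa [zpow_neg, zpow_natCast, ← inv_pow, ← mk_squareWalk_false]⟩

/-- For a nontrivial cyclically reduced `R` in the commutator subgroup of `F(a,b)`:
the Friedl–Tillmann polytope of `⟨a,b | R⟩` is a single point, i.e. the convex hull of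
the trace of `R` is a translate of the unit square, if and only if `R` is conjugate to
`[a,b]^k` for some integer `k`. -/
theorem polytope_point_iff_conj_commutator_pow (R : F) (hR1 : R ≠ 1)
    (hRc : R ∈ commutator F) (hcr : IsCyclicallyReduced R) :
    (∃ v : ℝ × ℝ, convexHull ℝ (trace R) = {v} + unitSquare) ↔
    (∃ k : ℤ, IsConj R (commAB ^ k)) := by
  constructor
  · rintro ⟨v, hv⟩
    obtain ⟨e, i, n, hR⟩ := exists_toWord_eq_squareWalk hRc hv
    exact exists_isConj_of_toWord_eq_squareWalk hR
  · rintro ⟨k, hk⟩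
    obtain ⟨e, i, n, hR⟩ := exists_toWord_eq_squareWalk_of_isConj hR1 hcr hk
    exact convexHull_trace_of_squareWalk (by omega) hR
end
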